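/- arXiv:2105.12459 — 3 statements merged into one kernel-verified Lean document; each statement's English description precedes it below -/
import Mathlib

section
/- Let β ∈ ℝ and δ > 0, let u ∈ H²(𝕋³) be divergence-free with mean zero, and let ω = ∇×u with ω ∈ H^{β+δ}(𝕋³). Assume there is C > 0 such that for all k, m, ℓ ∈ ℤ_{≥−1}, ∫_{𝕋³}(ω^ℓ·∇)u^m·ω^k dx ≤ C·2^{kβ}‖ω^ℓ‖_{L²}‖ω^m‖_{L²}‖ω^k‖_{L²}. Then there is a constant C_δ depending only on δ, β and C such that ∫_{𝕋³}(ω·∇)u·ω dx ≤ C_δ · ‖ω‖_{H^{β+δ}} · ‖ω‖²_{L²}. -/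
open MeasureTheory Real Filter
open scoped Classical

noncomputable section

abbrev Pt : Type := Fin 3 → ℝ

/-- The fundamental domain `[0,2π)³` of the torus `𝕋³ = (ℝ/2πℤ)³`. -/
def box : Set Pt := Set.univ.pi fun _ => Set.Ico (0 : ℝ) (2 * π)

/-- `2π`-periodicity in each coordinate. -/
def TPeriodic (g : Pt → ℝ) : Prop :=
  ∀ (x : Pt) (m : Fin 3 → ℤ), g (fun i => x i + 2 * π * (m i : ℝ)) = g x

def TPeriodicV (u : Pt → Pt) : Prop := ∀ i, TPeriodic fun x => u x i

/-- Fourier coefficient `ĝ(K) = (2π)⁻³ ∫_{𝕋³} g(x) e^{-iK·x} dx`. -/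
def fcoef (g : Pt → ℝ) (K : Fin 3 → ℤ) : ℂ :=
  ((2 * π : ℂ))⁻¹ ^ (3 : ℕ) *
    ∫ x in box, Complex.exp (-Complex.I * ∑ i, (K i : ℂ) * (x i : ℂ)) * (g x : ℂ)

/-- `|K|²` for a lattice frequency `K ∈ ℤ³`. -/
def nsq (K : Fin 3 → ℤ) : ℝ := ∑ i, ((K i : ℝ)) ^ 2

/-- Square of the `H^s(𝕋³)` norm, `Σ_K (1+|K|²)^s |û(K)|²`. -/
def sobSq (s : ℝ) (u : Pt → Pt) : ℝ :=
  ∑' K : Fin 3 → ℤ, (1 + nsq K) ^ s * ∑ i, ‖fcoef (fun x => u x i) K‖ ^ 2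

def sobNorm (s : ℝ) (u : Pt → Pt) : ℝ := Real.sqrt (sobSq s u)

/-- Membership in `H^s(𝕋³)` (for vector fields represented by periodic functions). -/
def MemHs (s : ℝ) (u : Pt → Pt) : Prop :=
  TPeriodicV u ∧ (∀ i, IntegrableOn (fun x => u x i) box) ∧
    Summable fun K : Fin 3 → ℤ => (1 + nsq K) ^ s * ∑ i, ‖fcoef (fun x => u x i) K‖ ^ 2

/-- Square of the `L²(𝕋³)` norm. -/
def l2Sq (u : Pt → Pt) : ℝ := ∫ x in box, ∑ i, (u x i) ^ 2

def l2N (u : Pt → Pt) : ℝ := Real.sqrt (l2Sq u)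

/-- The sharp annulus `2^k/√2 ≤ |K| < √2·2^k` (written with squares). -/
def inAnn (k : ℤ) (K : Fin 3 → ℤ) : Prop :=
  ((2 : ℝ) ^ k) ^ 2 / 2 ≤ nsq K ∧ nsq K < 2 * ((2 : ℝ) ^ k) ^ 2

/-- Sharp Littlewood–Paley block `u^k = F⁻¹[χ_{[2^k/√2,√2 2^k)} F u]`. -/
def lpBlock (k : ℤ) (u : Pt → Pt) : Pt → Pt := fun x i =>
  (∑' K : Fin 3 → ℤ,
      if inAnn k K then
        fcoef (fun y => u y i) K * Complex.exp (Complex.I * ∑ j, (K j : ℂ) * (x j : ℂ))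
      else 0).re

/-- Partial derivative `∂ᵢ`. -/
def pd (i : Fin 3) (g : Pt → ℝ) : Pt → ℝ := fun x => fderiv ℝ g x (Pi.single i 1)

def dotP (a b : Pt) : ℝ := ∑ i, a i * b i

def vdiv (u : Pt → Pt) : Pt → ℝ := fun x => ∑ i, pd i (fun y => u y i) x

/-- Curl `∇×u`. -/
def curl (u : Pt → Pt) : Pt → Pt := fun x =>
  ![pd 1 (fun y => u y 2) x - pd 2 (fun y => u y 1) x,
    pd 2 (fun y => u y 0) x - pd 0 (fun y => u y 2) x,
    pd 0 (fun y => u y 1) x - pd 1 (fun y => u y 0) x]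

/-- Convective derivative `(a·∇)b`. -/
def conv (a b : Pt → Pt) : Pt → Pt := fun x i => ∑ j, a x j * pd j (fun y => b y i) x

def vlap (u : Pt → Pt) : Pt → Pt := fun x i => ∑ j, pd j (pd j fun y => u y i) x

def gradP (p : Pt → ℝ) : Pt → Pt := fun x i => pd i p x

/-- Mean zero, via vanishing of the zeroth Fourier coefficient. -/
def fMeanZero (u : Pt → Pt) : Prop := ∀ i, fcoef (fun x => u x i) 0 = 0

/-- Divergence free, on the Fourier side: `K·û(K) = 0`. -/
def fDivFree (u : Pt → Pt) : Prop :=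
  ∀ K : Fin 3 → ℤ, ∑ i, (K i : ℂ) * fcoef (fun x => u x i) K = 0

/-- `u`, with pressure `p`, solves the Navier–Stokes equations classically
on the time set `S`, being smooth and periodic and divergence free in space. -/
def NSol (ν : ℝ) (S : Set ℝ) (f : ℝ → Pt → Pt) (u : ℝ → Pt → Pt) (p : ℝ → Pt → ℝ) : Prop :=
  (∀ t ∈ S, ContDiff ℝ (⊤ : ℕ∞) (u t) ∧ ContDiff ℝ (⊤ : ℕ∞) (p t) ∧ TPeriodicV (u t) ∧ TPeriodic (p t) ∧
    ∀ x, vdiv (u t) x = 0) ∧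
  ∀ t ∈ S, ∀ x, ∀ i, HasDerivWithinAt (fun τ => u τ x i)
      (-(conv (u t) (u t) x i) - gradP (p t) x i + ν * vlap (u t) x i + f t x i) S t

/-- Local-in-time strong solution on `[0,t_*)` with data `u₀`:
classical solution for positive times, continuous `[0,t_*) → H¹`. -/
def StrongSol (ν tstar : ℝ) (f : ℝ → Pt → Pt) (u₀ : Pt → Pt) (u : ℝ → Pt → Pt) : Prop :=
  u 0 = u₀ ∧
  (∃ p, NSol ν (Set.Ioo 0 tstar) f u p) ∧
  (∀ t ∈ Set.Ico 0 tstar, MemHs 1 (u t)) ∧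
  ∀ t ∈ Set.Ico 0 tstar,
    Tendsto (fun s => sobNorm 1 (fun x => u s x - u t x)) (nhdsWithin t (Set.Ico 0 tstar)) (nhds 0)

/-- The enstrophy-production bound
`∫ (ω^ℓ·∇)u^m·ω^k ≤ C 2^{kβ} ‖ω^ℓ‖‖ω^m‖‖ω^k‖` for all `k,m,ℓ ≥ -1`, `t ∈ T`. -/
def StretchBound (C β : ℝ) (T : Set ℝ) (u : ℝ → Pt → Pt) : Prop :=
  ∀ t ∈ T, ∀ k m ℓ : ℤ, -1 ≤ k → -1 ≤ m → -1 ≤ ℓ →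
    (∫ x in box, dotP (conv (lpBlock ℓ (curl (u t))) (lpBlock m (u t)) x) (lpBlock k (curl (u t)) x))
      ≤ C * (2 : ℝ) ^ ((k : ℝ) * β) * l2N (lpBlock ℓ (curl (u t))) *
          l2N (lpBlock m (curl (u t))) * l2N (lpBlock k (curl (u t)))

/-- `ω = ∇×u` on the Fourier side: `ω̂(K) = iK×û(K)`. -/
def fcurlRel (u ω : Pt → Pt) : Prop :=
  ∀ K : Fin 3 → ℤ,
    fcoef (fun x => ω x 0) K =
        Complex.I * ((K 1 : ℂ) * fcoef (fun x => u x 2) K -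
          (K 2 : ℂ) * fcoef (fun x => u x 1) K) ∧
    fcoef (fun x => ω x 1) K =
        Complex.I * ((K 2 : ℂ) * fcoef (fun x => u x 0) K -
          (K 0 : ℂ) * fcoef (fun x => u x 2) K) ∧
    fcoef (fun x => ω x 2) K =
        Complex.I * ((K 0 : ℂ) * fcoef (fun x => u x 1) K -
          (K 1 : ℂ) * fcoef (fun x => u x 0) K)

/-- The character `x ↦ e^{iK·x}` of the torus. -/
def torusChar (K : Fin 3 → ℤ) (x : Pt) : ℂ := Complex.exp (Complex.I * ∑ j, (K j : ℂ) * (x j : ℂ))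

lemma continuous_torusChar (K : Fin 3 → ℤ) : Continuous (torusChar K) := by
  unfold torusChar
  fun_prop

lemma torusChar_add (K L : Fin 3 → ℤ) (x : Pt) :
    torusChar (K + L) x = torusChar K x * torusChar L x := by
  simp only [torusChar, ← Complex.exp_add, ← mul_add, ← Finset.sum_add_distrib, Pi.add_apply,
    Int.cast_add, add_mul]

lemma conj_torusChar (K : Fin 3 → ℤ) (x : Pt) :
    (starRingEnd ℂ) (torusChar K x) = torusChar (-K) x := by
  simp only [torusChar, ← Complex.exp_conj, map_mul, map_sum, Complex.conj_I, Complex.conj_ofReal,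
    Pi.neg_apply, Int.cast_neg, neg_mul, Finset.sum_neg_distrib, mul_neg, map_intCast]

lemma norm_torusChar (K : Fin 3 → ℤ) (x : Pt) : ‖torusChar K x‖ = 1 := by
  have : Complex.I * ∑ j, (K j : ℂ) * (x j : ℂ) =
      ((∑ j, (K j : ℝ) * x j : ℝ) : ℂ) * Complex.I := by
    push_cast
    ring
  rw [torusChar, this, Complex.norm_exp_ofReal_mul_I]

lemma measurableSet_box : MeasurableSet box :=
  MeasurableSet.univ_pi fun _ => measurableSet_Ico

lemma volume_box : volume box = ENNReal.ofReal ((2 * π) ^ 3) := by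
  rw [box, Real.volume_pi_Ico]
  rw [Finset.prod_const, sub_zero, ← ENNReal.ofReal_pow two_pi_pos.le, Finset.card_univ,
    Fintype.card_fin]

instance : IsFiniteMeasure (volume.restrict box) :=
  ⟨by rw [Measure.restrict_apply_univ, volume_box]; exact ENNReal.ofReal_lt_top⟩

lemma Continuous.integrableOn_box {E : Type*} [NormedAddCommGroup E] {f : Pt → E}
    (hf : Continuous f) : IntegrableOn f box := by
  have hsub : box ⊆ Set.univ.pi fun _ => Set.Icc (0 : ℝ) (2 * π) :=
    Set.pi_mono fun _ _ => Set.Ico_subset_Icc_self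
  exact (hf.continuousOn.integrableOn_compact
    (isCompact_univ_pi fun _ => isCompact_Icc)).mono_set hsub

lemma integral_exp_int (n : ℤ) (hn : n ≠ 0) :
    ∫ x in Set.Ico (0 : ℝ) (2 * π), Complex.exp (Complex.I * (n * x)) = 0 := by
  rw [integral_Ico_eq_integral_Ioc, ← intervalIntegral.integral_of_le two_pi_pos.le]
  have h : Complex.I * n ≠ 0 := mul_ne_zero Complex.I_ne_zero (by exact_mod_cast hn)
  simp_rw [← mul_assoc]
  rw [integral_exp_mul_complex h]
  have : Complex.exp (Complex.I * n * ((2 * π : ℝ) : ℂ)) = 1 := by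
    rw [← Complex.exp_int_mul_two_pi_mul_I n]
    congr 1
    push_cast
    ring
  rw [this]
  simp

lemma integral_torusChar_of_ne_zero {K : Fin 3 → ℤ} (hK : K ≠ 0) :
    ∫ x in box, torusChar K x = 0 := by
  have h : ∀ x : Pt, torusChar K x = ∏ i, Complex.exp (Complex.I * (K i * x i)) := fun x => by
    rw [torusChar, Finset.mul_sum, Complex.exp_sum]
  simp_rw [h]
  rw [box, volume_pi, Measure.restrict_pi_pi,
    integral_fintype_prod_eq_prod (fun i (t : ℝ) => Complex.exp (Complex.I * (K i * t)))]
  obtain ⟨i, hi⟩ := Function.ne_iff.mp hK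
  exact Finset.prod_eq_zero (Finset.mem_univ i) (integral_exp_int _ hi)

lemma integral_torusChar_zero : ∫ x in box, torusChar 0 x = ((2 * π : ℝ) : ℂ) ^ 3 := by
  simp only [torusChar, Pi.zero_apply, Int.cast_zero, zero_mul, Finset.sum_const_zero, mul_zero,
    Complex.exp_zero, integral_const, measureReal_def, Measure.restrict_apply_univ, volume_box]
  rw [ENNReal.toReal_ofReal (by positivity)]
  simp

/-- The covering map from `ℝ³` to the unit torus that has period `2π` in each coordinate. -/
def toUnitTorus (x : Pt) : UnitAddTorus (Fin 3) := fun i => ((x i / (2 * π) : ℝ) : UnitAddCircle)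

lemma continuous_toUnitTorus : Continuous toUnitTorus :=
  continuous_pi fun i => (AddCircle.continuous_mk' 1).comp (by fun_prop)

lemma injOn_toUnitTorus : Set.InjOn toUnitTorus box := by
  intro x hx y hy hxy
  ext i
  have h := congrFun hxy i
  have key : ∀ z ∈ box, z i / (2 * π) ∈ Set.Ico (0 : ℝ) (0 + 1) := fun z hz => by
    have := hz i (Set.mem_univ i)
    exact ⟨div_nonneg this.1 two_pi_pos.le, by
      rw [zero_add, div_lt_one two_pi_pos]; exact this.2⟩
  have h2 := (AddCircle.coe_eq_coe_iff_of_mem_Ico (p := (1 : ℝ)) (key x hx) (key y hy)).mp h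
  exact (div_left_inj' two_pi_pos.ne').mp h2

lemma mFourier_toUnitTorus (K : Fin 3 → ℤ) (x : Pt) :
    UnitAddTorus.mFourier K (toUnitTorus x) = torusChar K x := by
  simp only [UnitAddTorus.mFourier, ContinuousMap.coe_mk, toUnitTorus, fourier_coe_apply, torusChar]
  rw [← Complex.exp_sum, Finset.mul_sum]
  congr 1
  refine Finset.sum_congr rfl fun i _ => ?_
  have : (π : ℂ) ≠ 0 := by exact_mod_cast pi_ne_zero
  push_cast
  field_simp

lemma integral_comp_toUnitTorus_mul_eq_zero {h : Pt → ℂ} (hh : IntegrableOn h box)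
    (h0 : ∀ K, ∫ x in box, torusChar K x * h x = 0) (φ : C(UnitAddTorus (Fin 3), ℂ)) :
    ∫ x in box, φ (toUnitTorus x) * h x = 0 := by
  have hint : ∀ φ : C(UnitAddTorus (Fin 3), ℂ),
      Integrable (fun x => φ (toUnitTorus x) * h x) (volume.restrict box) := fun φ =>
    hh.bdd_mul (c := ‖φ‖) (φ.continuous.comp continuous_toUnitTorus).aestronglyMeasurable
      (Filter.Eventually.of_forall fun x => φ.norm_coe_le_norm _)
  let T : C(UnitAddTorus (Fin 3), ℂ) →ₗ[ℂ] ℂ :=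
    { toFun := fun φ => ∫ x in box, φ (toUnitTorus x) * h x
      map_add' := fun a b => by
        simp only [ContinuousMap.add_apply, add_mul]
        exact integral_add (hint a) (hint b)
      map_smul' := fun c a => by
        simp only [ContinuousMap.smul_apply, smul_eq_mul, mul_assoc, RingHom.id_apply]
        exact integral_const_mul _ _ }
  let Tc : C(UnitAddTorus (Fin 3), ℂ) →L[ℂ] ℂ := T.mkContinuous (∫ x in box, ‖h x‖) fun φ => by
    change ‖∫ x in box, φ (toUnitTorus x) * h x‖ ≤ _
    rw [mul_comm, ← integral_const_mul]
    refine norm_integral_le_of_norm_le (hh.norm.const_mul _)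
      (Filter.Eventually.of_forall fun x => ?_)
    rw [norm_mul]
    exact mul_le_mul_of_nonneg_right (φ.norm_coe_le_norm _) (norm_nonneg _)
  have hker : (Submodule.span ℂ (Set.range (UnitAddTorus.mFourier (d := Fin 3)))).topologicalClosure
      ≤ LinearMap.ker (Tc : C(UnitAddTorus (Fin 3), ℂ) →ₗ[ℂ] ℂ) := by
    refine Submodule.topologicalClosure_minimal _ (Submodule.span_le.mpr ?_) Tc.isClosed_ker
    rintro _ ⟨K, rfl⟩
    change ∫ x in box, UnitAddTorus.mFourier K (toUnitTorus x) * h x = 0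
    simpa only [mFourier_toUnitTorus] using h0 K
  rw [UnitAddTorus.span_mFourier_closure_eq_top] at hker
  exact hker (Submodule.mem_top (x := φ))

lemma ae_eq_zero_of_integral_comp_toUnitTorus {h : Pt → ℝ} (hh : IntegrableOn h box)
    (h0 : ∀ φ : C(UnitAddTorus (Fin 3), ℝ), ∫ x in box, φ (toUnitTorus x) * h x = 0) :
    h =ᵐ[volume.restrict box] 0 := by
  set μ := volume.restrict box with hμ
  have hm : AEMeasurable h μ := hh.aestronglyMeasurable.aemeasurable
  set p : Pt → ENNReal := fun x => ENNReal.ofReal (h x) with hp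
  set n : Pt → ENNReal := fun x => ENNReal.ofReal (-h x) with hn
  have hpm : AEMeasurable p μ := hm.ennreal_ofReal
  have hnm : AEMeasurable n μ := hm.neg.ennreal_ofReal
  have : IsFiniteMeasure (μ.withDensity p) := isFiniteMeasure_withDensity_ofReal hh.2
  have : IsFiniteMeasure (μ.withDensity n) := isFiniteMeasure_withDensity_ofReal hh.neg.2
  have hq : Measurable toUnitTorus := continuous_toUnitTorus.measurable
  have hmap : (μ.withDensity p).map toUnitTorus = (μ.withDensity n).map toUnitTorus := by
    refine ext_of_forall_integral_eq_of_IsFiniteMeasure fun φ => ?_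
    have hφ : Continuous fun x => φ (toUnitTorus x) := φ.continuous.comp continuous_toUnitTorus
    rw [integral_map hq.aemeasurable φ.continuous.aestronglyMeasurable,
      integral_map hq.aemeasurable φ.continuous.aestronglyMeasurable,
      integral_withDensity_eq_integral_toReal_smul₀ hpm
        (Filter.Eventually.of_forall fun _ => ENNReal.ofReal_lt_top),
      integral_withDensity_eq_integral_toReal_smul₀ hnm
        (Filter.Eventually.of_forall fun _ => ENNReal.ofReal_lt_top), ← sub_eq_zero,
      ← integral_sub, ← h0 φ.toContinuousMap]
    · refine integral_congr_ae (Filter.Eventually.of_forall fun x => ?_)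
      simp only [hp, hn, ENNReal.toReal_ofReal', smul_eq_mul]
      change _ = φ (toUnitTorus x) * h x
      rcases le_total 0 (h x) with hx | hx
      · rw [max_eq_left hx, max_eq_right (by linarith)]; ring
      · rw [max_eq_right hx, max_eq_left (by linarith)]; ring
    · simp only [hp, ENNReal.toReal_ofReal', smul_eq_mul]
      exact hh.pos_part.mul_bdd (c := ‖φ‖) hφ.aestronglyMeasurable
        (Filter.Eventually.of_forall fun x => φ.norm_coe_le_norm _)
    · simp only [hn, ENNReal.toReal_ofReal', smul_eq_mul]
      exact hh.neg_part.mul_bdd (c := ‖φ‖) hφ.aestronglyMeasurable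
        (Filter.Eventually.of_forall fun x => φ.norm_coe_le_norm _)
  have heq : μ.withDensity p = μ.withDensity n := by
    ext s hs
    have hsb : MeasurableSet (s ∩ box) := hs.inter measurableSet_box
    have him : MeasurableSet (toUnitTorus '' (s ∩ box)) :=
      hsb.image_of_continuousOn_injOn continuous_toUnitTorus.continuousOn
        (injOn_toUnitTorus.mono Set.inter_subset_right)
    have hrepr : ∀ ν : Measure Pt, ν.AbsolutelyContinuous μ → ν s = ν.map toUnitTorus (toUnitTorus '' (s ∩ box)) := by
      intro ν hν
      rw [Measure.map_apply hq him]
      refine measure_congr ?_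
      have hbox : ∀ᵐ x ∂ν, x ∈ box := hν.ae_le (ae_restrict_mem measurableSet_box)
      filter_upwards [hbox] with x hx
      refine propext ⟨fun h => ⟨x, ⟨h, hx⟩, rfl⟩, ?_⟩
      rintro ⟨y, ⟨hys, hyb⟩, hyx⟩
      rwa [← injOn_toUnitTorus hyb hx hyx]
    rw [hrepr _ (withDensity_absolutelyContinuous _ _),
      hrepr _ (withDensity_absolutelyContinuous _ _), hmap]
  have hae := (withDensity_eq_iff hpm hnm hh.lintegral_lt_top.ne).mp heq
  filter_upwards [hae] with x hx
  simp only [hp, hn] at hx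
  have h1 := congrArg ENNReal.toReal hx
  simp only [ENNReal.toReal_ofReal'] at h1
  rcases le_total 0 (h x) with h2 | h2
  · rw [max_eq_left h2, max_eq_right (by linarith)] at h1; exact h1
  · rw [max_eq_right h2, max_eq_left (by linarith)] at h1; simp only [Pi.zero_apply]; linarith

/-- An integrable function on the torus all of whose Fourier coefficients vanish is zero. -/
lemma ae_eq_zero_of_forall_integral_torusChar {h : Pt → ℂ} (hh : IntegrableOn h box)
    (h0 : ∀ K, ∫ x in box, torusChar K x * h x = 0) : h =ᵐ[volume.restrict box] 0 := by
  have key := integral_comp_toUnitTorus_mul_eq_zero hh h0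
  have hint : ∀ φ : C(UnitAddTorus (Fin 3), ℝ),
      Integrable (fun x => ((φ (toUnitTorus x) : ℝ) : ℂ) * h x) (volume.restrict box) := fun φ =>
    hh.bdd_mul (c := ‖φ‖) (by
        have := φ.continuous.comp continuous_toUnitTorus
        exact (Complex.continuous_ofReal.comp this).aestronglyMeasurable)
      (Filter.Eventually.of_forall fun x => by
        rw [Complex.norm_real]; exact φ.norm_coe_le_norm _)
  have hz : ∀ φ : C(UnitAddTorus (Fin 3), ℝ),
      ∫ x in box, ((φ (toUnitTorus x) : ℝ) : ℂ) * h x = 0 := fun φ =>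
    key ⟨fun t => ((φ t : ℝ) : ℂ), by fun_prop⟩
  have hre := ae_eq_zero_of_integral_comp_toUnitTorus (h := fun x => (h x).re) hh.re fun φ => by
    have h1 := integral_re (𝕜 := ℂ) (hint φ)
    rw [hz φ] at h1
    simpa using h1
  have him := ae_eq_zero_of_integral_comp_toUnitTorus (h := fun x => (h x).im) hh.im fun φ => by
    have h1 := integral_im (𝕜 := ℂ) (hint φ)
    rw [hz φ] at h1
    simpa using h1
  filter_upwards [hre, him] with x h1 h2
  exact Complex.ext h1 h2

lemma integral_conj_torusChar_mul (K L : Fin 3 → ℤ) :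
    ∫ x in box, (starRingEnd ℂ) (torusChar K x) * torusChar L x =
      if K = L then ((2 * π : ℝ) : ℂ) ^ 3 else 0 := by
  simp_rw [conj_torusChar, ← torusChar_add]
  split_ifs with h
  · rw [h, neg_add_cancel, integral_torusChar_zero]
  · exact integral_torusChar_of_ne_zero fun h0 => h (neg_add_eq_zero.mp h0)

lemma volume_mul_fcoef (f : Pt → ℝ) (K : Fin 3 → ℤ) :
    ((2 * π : ℝ) : ℂ) ^ 3 * fcoef f K = ∫ x in box, torusChar (-K) x * (f x : ℂ) := by
  have h : ((2 * π : ℝ) : ℂ) ≠ 0 := by exact_mod_cast two_pi_pos.ne'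
  have h2 : ∀ x : Pt, torusChar (-K) x = Complex.exp (-Complex.I * ∑ i, (K i : ℂ) * (x i : ℂ)) :=
    fun x => by simp [torusChar]
  simp_rw [fcoef, h2]
  push_cast at h ⊢
  rw [← mul_assoc, ← mul_pow, mul_inv_cancel₀ h, one_pow, one_mul]

lemma memLp_normalized_torusChar (K : Fin 3 → ℤ) :
    MemLp (fun x => ((√((2 * π) ^ 3))⁻¹ : ℂ) * torusChar K x) 2 (volume.restrict box) := by
  refine MemLp.of_bound (C := ‖((√((2 * π) ^ 3))⁻¹ : ℂ)‖)
    (continuous_const.mul (continuous_torusChar K)).aestronglyMeasurable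
    (Filter.Eventually.of_forall fun x => ?_)
  rw [norm_mul, norm_torusChar, mul_one]

/-- The normalized character as an element of `L²(𝕋³)`. -/
def torusCharLp (K : Fin 3 → ℤ) : Lp ℂ 2 (volume.restrict box) :=
  (memLp_normalized_torusChar K).toLp

lemma inner_torusCharLp (K : Fin 3 → ℤ) (g : Lp ℂ 2 (volume.restrict box)) :
    inner ℂ (torusCharLp K) g =
      ((√((2 * π) ^ 3))⁻¹ : ℂ) * ∫ x in box, torusChar (-K) x * g x := by
  rw [L2.inner_def, ← integral_const_mul]
  refine integral_congr_ae ?_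
  filter_upwards [(memLp_normalized_torusChar K).coeFn_toLp] with x hx
  rw [torusCharLp, hx, RCLike.inner_apply, map_mul, conj_torusChar, map_inv₀, Complex.conj_ofReal]
  ring

lemma orthonormal_torusCharLp : Orthonormal ℂ torusCharLp := by
  rw [orthonormal_iff_ite]
  intro K L
  rw [inner_torusCharLp]
  have h1 : ∫ x in box, torusChar (-K) x * torusCharLp L x =
      ((√((2 * π) ^ 3))⁻¹ : ℂ) *
        ∫ x in box, (starRingEnd ℂ) (torusChar K x) * torusChar L x := by
    rw [← integral_const_mul]
    refine integral_congr_ae ?_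
    filter_upwards [(memLp_normalized_torusChar L).coeFn_toLp] with x hx
    rw [torusCharLp, hx, conj_torusChar]
    ring
  rw [h1, integral_conj_torusChar_mul]
  split_ifs
  · have h : (0 : ℝ) < (2 * π) ^ 3 := by positivity
    have h2 : √((2 * π) ^ 3) ≠ 0 := (Real.sqrt_pos.mpr h).ne'
    have h3 : (√((2 * π) ^ 3))⁻¹ * ((√((2 * π) ^ 3))⁻¹ * (2 * π) ^ 3) = (1 : ℝ) := by
      rw [← mul_assoc, ← mul_inv, Real.mul_self_sqrt h.le, inv_mul_cancel₀ h.ne']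
    exact_mod_cast h3
  · simp

/-- Parseval's identity on the torus, including the fact that an integrable function with
square-summable Fourier coefficients is square integrable. -/
lemma parseval_box {f : Pt → ℝ} (hf : IntegrableOn f box)
    (hs : Summable fun K => ‖fcoef f K‖ ^ 2) :
    IntegrableOn (fun x => f x ^ 2) box ∧
      ∫ x in box, f x ^ 2 = (2 * π) ^ 3 * ∑' K, ‖fcoef f K‖ ^ 2 := by
  set V : ℝ := (2 * π) ^ 3 with hV
  have hV0 : 0 < V := by positivity
  set r : ℝ := √V with hr
  have hr0 : r ≠ 0 := (Real.sqrt_pos.mpr hV0).ne'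
  have hnorm : ∀ K, ‖(r : ℂ) * fcoef f K‖ ^ 2 = V * ‖fcoef f K‖ ^ 2 := fun K => by
    rw [norm_mul, mul_pow, Complex.norm_real, Real.norm_eq_abs, sq_abs, hr, Real.sq_sqrt hV0.le]
  have hmem : Memℓp (fun K => (r : ℂ) * fcoef f K) 2 := by
    refine memℓp_gen ?_
    have : (2 : ENNReal).toReal = ((2 : ℕ) : ℝ) := by norm_num
    simp_rw [this, Real.rpow_natCast, hnorm]
    exact hs.mul_left V
  let b : lp (fun _ : Fin 3 → ℤ => ℂ) 2 := ⟨_, hmem⟩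
  let T := orthonormal_torusCharLp.orthogonalFamily.linearIsometry
  set g : Lp ℂ 2 (volume.restrict box) := T b with hg
  have hinner : ∀ K, inner ℂ (torusCharLp K) g = (r : ℂ) * fcoef f K := fun K => by
    have h1 : torusCharLp K = T (lp.single 2 K (1 : ℂ)) := by
      simp only [T, OrthogonalFamily.linearIsometry_apply_single]
      simp
    rw [h1, hg, LinearIsometry.inner_map_map, lp.inner_single_left]
    simp [b]
  have hgint : Integrable (fun x => g x) (volume.restrict box) :=
    (Lp.memLp g).integrable (by norm_num)
  have hfc : Integrable (fun x => (f x : ℂ)) (volume.restrict box) := hf.ofReal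
  have hcoef : ∀ K, ∫ x in box, torusChar K x * ((f x : ℂ) - g x) = 0 := fun K => by
    have hi : ∀ {q : Pt → ℂ}, IntegrableOn q box →
        Integrable (fun x => torusChar K x * q x) (volume.restrict box) := fun hq =>
      hq.bdd_mul (c := 1) (continuous_torusChar K).aestronglyMeasurable
        (Filter.Eventually.of_forall fun x => (norm_torusChar K x).le)
    simp_rw [mul_sub]
    rw [integral_sub (hi hfc) (hi hgint)]
    have h1 := hinner (-K)
    rw [inner_torusCharLp, neg_neg] at h1
    have h2 := volume_mul_fcoef f (-K)
    rw [neg_neg] at h2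
    have h3 : ((r : ℂ))⁻¹ * ∫ x in box, torusChar K x * g x = (r : ℂ) * fcoef f (-K) := h1
    have hrC : (r : ℂ) ≠ 0 := by exact_mod_cast hr0
    have h4 : (r : ℂ) * r = ((2 * π : ℝ) : ℂ) ^ 3 := by
      have : r * r = V := Real.mul_self_sqrt hV0.le
      rw [hV] at this
      exact_mod_cast this
    rw [inv_mul_eq_iff_eq_mul₀ hrC, ← mul_assoc, h4, h2] at h3
    rw [h3, sub_self]
  have hae := ae_eq_zero_of_forall_integral_torusChar (hfc.sub hgint) hcoef
  have hsq : (fun x => f x ^ 2) =ᵐ[volume.restrict box] fun x => ‖g x‖ ^ 2 := by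
    filter_upwards [hae] with x hx
    have : (f x : ℂ) = g x := sub_eq_zero.mp hx
    rw [← this, Complex.norm_real, Real.norm_eq_abs, sq_abs]
  have hgsq : Integrable (fun x => ‖g x‖ ^ 2) (volume.restrict box) :=
    (memLp_two_iff_integrable_sq_norm (Lp.memLp g).1).mp (Lp.memLp g)
  refine ⟨hgsq.congr hsq.symm, ?_⟩
  rw [integral_congr_ae hsq, ← tsum_mul_left]
  have h1 : ∫ x in box, ‖g x‖ ^ 2 = ‖g‖ ^ 2 := by
    rw [← inner_self_eq_norm_sq (𝕜 := ℂ), L2.inner_def, ← integral_re (L2.integrable_inner g g)]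
    simp only [inner_self_eq_norm_sq]
  rw [h1, hg, LinearIsometry.norm_map]
  have h2 := lp.norm_rpow_eq_tsum (p := 2) (by norm_num) b
  have : (2 : ENNReal).toReal = ((2 : ℕ) : ℝ) := by norm_num
  simp_rw [this, Real.rpow_natCast] at h2
  rw [h2]
  exact tsum_congr hnorm

/-- Two of the three dyadic frequencies `2^k`, `2^m`, `2^l` can cancel only under this relation. -/
def DyadicNear (k m l : ℤ) : Prop := |m - l| ≤ 2 ∨ (m ≤ k + 1 ∧ l ≤ k + 1)

lemma sum_dyadicNear_le {a : ℤ → ℝ} {A : ℝ} {G : Finset ℤ}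
    (hG : ∀ k ∈ G, -1 ≤ k) (hA : ∑ k ∈ G, a k ^ 2 ≤ A) {k : ℤ} (hk : -1 ≤ k) :
    ∑ m ∈ G, ∑ l ∈ G, (if DyadicNear k m l then a m * a l else 0) ≤
      (5 + ((k : ℝ) + 3) ^ 2) * A := by
  have hA0 : 0 ≤ A := (Finset.sum_nonneg fun _ _ => sq_nonneg _).trans hA
  have hsingle : ∀ m ∈ G, a m ^ 2 ≤ A := fun m hm =>
    (Finset.single_le_sum (f := fun k => a k ^ 2) (fun _ _ => sq_nonneg _) hm).trans hA
  have hrow : ∀ m, ((G.filter fun l => |m - l| ≤ 2).card : ℝ) ≤ 5 := fun m => by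
    have hsub : (G.filter fun l => |m - l| ≤ 2) ⊆ Finset.Icc (m - 2) (m + 2) := fun l hl => by
      have := abs_le.mp (Finset.mem_filter.mp hl).2
      rw [Finset.mem_Icc]
      omega
    have h := Finset.card_le_card hsub
    rw [Int.card_Icc] at h
    have h5 : (m + 2 + 1 - (m - 2)).toNat = 5 := by omega
    rw [h5] at h
    exact_mod_cast h
  have hlow : ((G.filter fun l => l ≤ k + 1).card : ℝ) ≤ (k : ℝ) + 3 := by
    have hsub : (G.filter fun l => l ≤ k + 1) ⊆ Finset.Icc (-1) (k + 1) := fun l hl => by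
      rw [Finset.mem_filter] at hl
      exact Finset.mem_Icc.mpr ⟨hG l hl.1, hl.2⟩
    have h := Finset.card_le_card hsub
    rw [Int.card_Icc] at h
    have h3 : ((G.filter fun l => l ≤ k + 1).card : ℤ) ≤ k + 3 := by omega
    exact_mod_cast h3
  have hdiag : ∑ m ∈ G, ∑ l ∈ G, (if |m - l| ≤ 2 then a m ^ 2 else 0) ≤ 5 * A := by
    calc ∑ m ∈ G, ∑ l ∈ G, (if |m - l| ≤ 2 then a m ^ 2 else 0)
        = ∑ m ∈ G, ((G.filter fun l => |m - l| ≤ 2).card : ℝ) * a m ^ 2 := by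
          refine Finset.sum_congr rfl fun m _ => ?_
          rw [← Finset.sum_filter, Finset.sum_const, nsmul_eq_mul]
      _ ≤ ∑ m ∈ G, 5 * a m ^ 2 :=
          Finset.sum_le_sum fun m _ => mul_le_mul_of_nonneg_right (hrow m) (sq_nonneg _)
      _ ≤ 5 * A := by rw [← Finset.mul_sum]; linarith
  have hdiag' : ∑ m ∈ G, ∑ l ∈ G, (if |m - l| ≤ 2 then a l ^ 2 else 0) ≤ 5 * A := by
    rw [Finset.sum_comm]
    simpa only [abs_sub_comm] using hdiag
  have hbox : ∑ m ∈ G, ∑ l ∈ G, (if m ≤ k + 1 ∧ l ≤ k + 1 then A else 0) ≤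
      ((k : ℝ) + 3) ^ 2 * A := by
    have h : ∀ m l : ℤ, (if m ≤ k + 1 ∧ l ≤ k + 1 then A else 0) =
        (if m ≤ k + 1 then 1 else 0) * (if l ≤ k + 1 then 1 else 0) * A := fun m l => by
      by_cases h1 : m ≤ k + 1 <;> by_cases h2 : l ≤ k + 1 <;> simp [h1, h2]
    simp_rw [h, ← Finset.sum_mul, ← Finset.sum_mul_sum, Finset.sum_boole]
    refine mul_le_mul_of_nonneg_right ?_ hA0
    rw [sq]
    exact mul_le_mul hlow hlow (Nat.cast_nonneg _) ((Nat.cast_nonneg _).trans hlow)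
  have hpt : ∀ m ∈ G, ∀ l ∈ G, (if DyadicNear k m l then a m * a l else 0) ≤
      ((if |m - l| ≤ 2 then a m ^ 2 else 0) + (if |m - l| ≤ 2 then a l ^ 2 else 0)) / 2 +
        (if m ≤ k + 1 ∧ l ≤ k + 1 then A else 0) := fun m hm l hl => by
    have h1 := hsingle m hm
    have h2 := hsingle l hl
    have h3 := sq_nonneg (a m - a l)
    have h4 := sq_nonneg (a m)
    have h5 := sq_nonneg (a l)
    unfold DyadicNear
    by_cases c1 : |m - l| ≤ 2 <;> by_cases c2 : m ≤ k + 1 ∧ l ≤ k + 1 <;>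
      simp only [c1, c2, if_true, if_false, or_true, or_false, and_self] <;> nlinarith
  calc _ ≤ ∑ m ∈ G, ∑ l ∈ G,
      (((if |m - l| ≤ 2 then a m ^ 2 else 0) + (if |m - l| ≤ 2 then a l ^ 2 else 0)) / 2 +
        (if m ≤ k + 1 ∧ l ≤ k + 1 then A else 0)) :=
        Finset.sum_le_sum fun m hm => Finset.sum_le_sum fun l hl => hpt m hm l hl
    _ ≤ _ := by
      simp_rw [Finset.sum_add_distrib, ← Finset.sum_div, Finset.sum_add_distrib]
      linarith

lemma exists_sum_dyadic_weight_le {δ : ℝ} (hδ : 0 < δ) :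
    ∃ D > (0 : ℝ), ∀ G : Finset ℤ, (∀ k ∈ G, -1 ≤ k) →
      ∑ k ∈ G, ((2 : ℝ) ^ (-(k : ℝ) * δ) * (5 + ((k : ℝ) + 3) ^ 2)) ^ 2 ≤ D ^ 2 := by
  set r : ℝ := ((2 : ℝ) ^ (-δ)) ^ 2 with hr
  have h2 : (2 : ℝ) ^ (-δ) < 1 := Real.rpow_lt_one_of_one_lt_of_neg (by norm_num) (by linarith)
  have h20 : 0 < (2 : ℝ) ^ (-δ) := by positivity
  have hr1 : ‖r‖ < 1 := by
    rw [Real.norm_eq_abs, abs_of_nonneg (sq_nonneg _)]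
    exact pow_lt_one₀ h20.le h2 (by norm_num)
  set g : ℕ → ℝ := fun n => ((2 : ℝ) ^ δ) ^ 2 * (r ^ n * (5 + ((n : ℝ) + 2) ^ 2) ^ 2) with hg
  have hgs : Summable g := by
    refine Summable.mul_left _ ?_
    have hs := fun j : ℕ => summable_pow_mul_geometric_of_norm_lt_one (R := ℝ) j hr1
    refine (((hs 4).add ((hs 3).mul_left 8)).add (((hs 2).mul_left 34).add
      (((hs 1).mul_left 72).add ((hs 0).mul_left 81)))).congr fun n => ?_
    ring
  have hg0 : ∀ n, 0 ≤ g n := fun n => by positivity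
  refine ⟨√(∑' n, g n) + 1, by positivity, fun G hG => ?_⟩
  have hterm : ∀ k ∈ G, ((2 : ℝ) ^ (-(k : ℝ) * δ) * (5 + ((k : ℝ) + 3) ^ 2)) ^ 2 =
      g (k + 1).toNat := fun k hk => by
    have hk1 := hG k hk
    have hc : (((k + 1).toNat : ℕ) : ℝ) = (k : ℝ) + 1 := by
      have : (((k + 1).toNat : ℕ) : ℤ) = k + 1 := Int.toNat_of_nonneg (by omega)
      exact_mod_cast congrArg (Int.cast (R := ℝ)) this
    have hp : (2 : ℝ) ^ (-(k : ℝ) * δ) = (2 : ℝ) ^ δ * ((2 : ℝ) ^ (-δ)) ^ (k + 1).toNat := by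
      rw [← Real.rpow_natCast, hc, ← Real.rpow_mul (by norm_num), ← Real.rpow_add (by norm_num)]
      congr 1
      ring
    simp only [hg, hr]
    rw [hc, hp]
    ring
  have hinj : Set.InjOn (fun k : ℤ => (k + 1).toNat) G := fun x hx y hy hxy => by
    have h1 := hG x hx
    have h2 := hG y hy
    simp only at hxy
    omega
  rw [Finset.sum_congr rfl hterm, ← Finset.sum_image (f := g) hinj]
  have h0 : 0 ≤ ∑' n, g n := tsum_nonneg hg0
  calc _ ≤ ∑' n, g n := hgs.sum_le_tsum _ fun n _ => hg0 n
    _ = √(∑' n, g n) ^ 2 := (Real.sq_sqrt h0).symm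
    _ ≤ _ := pow_le_pow_left₀ (Real.sqrt_nonneg _) (by linarith) 2

/-- The dyadic summation estimate behind the paraproduct decomposition. -/
lemma exists_trilinear_dyadic_sum_le (β : ℝ) {δ : ℝ} (hδ : 0 < δ) :
    ∃ D > (0 : ℝ), ∀ (a : ℤ → ℝ) (A S : ℝ) (G : Finset ℤ), (∀ k, 0 ≤ a k) → 0 ≤ S →
      (∀ k ∈ G, -1 ≤ k) → ∑ k ∈ G, a k ^ 2 ≤ A →
      ∑ k ∈ G, ((2 : ℝ) ^ ((k : ℝ) * (β + δ)) * a k) ^ 2 ≤ S ^ 2 →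
      ∑ k ∈ G, ∑ m ∈ G, ∑ l ∈ G,
        (if DyadicNear k m l then (2 : ℝ) ^ ((k : ℝ) * β) * a l * a m * a k else 0) ≤
          D * S * A := by
  obtain ⟨D, hD, hw⟩ := exists_sum_dyadic_weight_le hδ
  refine ⟨D, hD, fun a A S G ha hS hG hA hSS => ?_⟩
  have hA0 : 0 ≤ A := (Finset.sum_nonneg fun _ _ => sq_nonneg _).trans hA
  set w : ℤ → ℝ := fun k => (2 : ℝ) ^ (-(k : ℝ) * δ) * (5 + ((k : ℝ) + 3) ^ 2) with hwdef
  set b : ℤ → ℝ := fun k => (2 : ℝ) ^ ((k : ℝ) * (β + δ)) * a k with hbdef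
  have hrow : ∀ k ∈ G, ∑ m ∈ G, ∑ l ∈ G,
      (if DyadicNear k m l then (2 : ℝ) ^ ((k : ℝ) * β) * a l * a m * a k else 0) ≤
        w k * b k * A := fun k hk => by
    have h1 : ∀ m l : ℤ,
        (if DyadicNear k m l then (2 : ℝ) ^ ((k : ℝ) * β) * a l * a m * a k else 0) =
          (2 : ℝ) ^ ((k : ℝ) * β) * a k * (if DyadicNear k m l then a m * a l else 0) :=
      fun m l => by split_ifs <;> ring
    simp_rw [h1, ← Finset.mul_sum]
    have h2 := mul_le_mul_of_nonneg_left (sum_dyadicNear_le hG hA (hG k hk))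
      (mul_nonneg (by positivity : (0 : ℝ) ≤ (2 : ℝ) ^ ((k : ℝ) * β)) (ha k))
    refine h2.trans (le_of_eq ?_)
    have h3 : (2 : ℝ) ^ ((k : ℝ) * β) =
        (2 : ℝ) ^ (-(k : ℝ) * δ) * (2 : ℝ) ^ ((k : ℝ) * (β + δ)) := by
      rw [← Real.rpow_add (by norm_num)]
      congr 1
      ring
    simp only [hwdef, hbdef]
    rw [h3]
    ring
  calc _ ≤ ∑ k ∈ G, w k * b k * A := Finset.sum_le_sum hrow
    _ = (∑ k ∈ G, w k * b k) * A := by rw [Finset.sum_mul]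
    _ ≤ D * S * A := by
      refine mul_le_mul_of_nonneg_right ?_ hA0
      refine abs_le_of_sq_le_sq' ?_ (mul_nonneg hD.le hS) |>.2
      calc (∑ k ∈ G, w k * b k) ^ 2 ≤ (∑ k ∈ G, w k ^ 2) * ∑ k ∈ G, b k ^ 2 :=
            Finset.sum_mul_sq_le_sq_mul_sq _ _ _
        _ ≤ D ^ 2 * S ^ 2 :=
            mul_le_mul (hw G hG) hSS (Finset.sum_nonneg fun _ _ => sq_nonneg _) (sq_nonneg _)
        _ = (D * S) ^ 2 := by ring

lemma nsq_nonneg (K : Fin 3 → ℤ) : 0 ≤ nsq K := Finset.sum_nonneg fun _ _ => sq_nonneg _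

lemma nsq_neg (K : Fin 3 → ℤ) : nsq (-K) = nsq K := by simp [nsq]

lemma nsq_add_le (K L : Fin 3 → ℤ) : nsq (K + L) ≤ 2 * nsq K + 2 * nsq L := by
  simp only [nsq, Finset.mul_sum, ← Finset.sum_add_distrib]
  refine Finset.sum_le_sum fun i _ => ?_
  push_cast [Pi.add_apply]
  nlinarith [sq_nonneg ((K i : ℝ) - L i)]

lemma inAnn_neg {k : ℤ} {K : Fin 3 → ℤ} (h : inAnn k K) : inAnn k (-K) := by
  simpa only [inAnn, nsq_neg] using h

lemma finite_setOf_inAnn (k : ℤ) : {K | inAnn k K}.Finite := by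
  obtain ⟨N, hN⟩ := exists_nat_gt (2 * ((2 : ℝ) ^ k) ^ 2)
  refine (Set.finite_Icc (fun _ => -(N : ℤ)) (fun _ => (N : ℤ))).subset fun K hK => ?_
  have hi : ∀ i, |K i| ≤ (N : ℤ) := fun i => by
    have h1 : ((K i : ℝ)) ^ 2 ≤ nsq K :=
      Finset.single_le_sum (f := fun i => ((K i : ℝ)) ^ 2) (fun _ _ => sq_nonneg _)
        (Finset.mem_univ i)
    have h2 : ((K i : ℝ)) ^ 2 ≤ N := h1.trans (hK.2.le.trans hN.le)
    have h3 : (K i) ^ 2 ≤ (N : ℤ) := by exact_mod_cast h2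
    exact (Int.le_self_sq _).trans (by rwa [sq_abs])
  exact ⟨fun i => (abs_le.mp (hi i)).1, fun i => (abs_le.mp (hi i)).2⟩

/-- The lattice points of the `k`-th dyadic annulus. -/
def annulus (k : ℤ) : Finset (Fin 3 → ℤ) := (finite_setOf_inAnn k).toFinset

lemma mem_annulus {k : ℤ} {K : Fin 3 → ℤ} : K ∈ annulus k ↔ inAnn k K := by simp [annulus]

lemma add_add_ne_zero_of_inAnn {k l m : ℤ} {K L M : Fin 3 → ℤ} (hK : inAnn k K) (hL : inAnn l L)
    (hM : inAnn m M) (hl : l + 3 ≤ m) (hk : k + 2 ≤ m) : K + L + M ≠ 0 := by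
  intro h
  have hM' : M = -(K + L) := (neg_eq_of_add_eq_zero_right h).symm
  have h1 : nsq M ≤ 2 * nsq K + 2 * nsq L := by
    rw [hM', nsq_neg]
    exact nsq_add_le K L
  have h2 : (2 : ℝ) ^ l * 8 ≤ (2 : ℝ) ^ m := by
    have : (2 : ℝ) ^ l * 8 = (2 : ℝ) ^ (l + 3) := by
      rw [zpow_add₀ (by norm_num)]
      norm_num
    rw [this]
    exact zpow_le_zpow_right₀ (by norm_num) hl
  have h3 : (2 : ℝ) ^ k * 4 ≤ (2 : ℝ) ^ m := by
    have : (2 : ℝ) ^ k * 4 = (2 : ℝ) ^ (k + 2) := by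
      rw [zpow_add₀ (by norm_num)]
      norm_num
    rw [this]
    exact zpow_le_zpow_right₀ (by norm_num) hk
  have p1 : (0 : ℝ) < (2 : ℝ) ^ l := by positivity
  have p2 : (0 : ℝ) < (2 : ℝ) ^ k := by positivity
  have p3 : (0 : ℝ) < (2 : ℝ) ^ m := by positivity
  have q1 := pow_le_pow_left₀ (by positivity) h2 2
  have q2 := pow_le_pow_left₀ (by positivity) h3 2
  have a1 := hM.1
  have a2 := hK.2
  have a3 := hL.2
  nlinarith [pow_pos p3 2]

lemma add_add_ne_zero_of_not_dyadicNear {k m l : ℤ} {K L M : Fin 3 → ℤ} (hK : inAnn k K)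
    (hL : inAnn l L) (hM : inAnn m M) (h : ¬ DyadicNear k m l) : K + L + M ≠ 0 := by
  simp only [DyadicNear, not_or, not_le, not_and_or, lt_abs] at h
  by_cases hml : l < m
  · exact add_add_ne_zero_of_inAnn hK hL hM (by omega) (by omega)
  · rw [add_right_comm]
    exact add_add_ne_zero_of_inAnn hK hM hL (by omega) (by omega)

/-- The real part of a trigonometric polynomial. -/
def reTrigPoly (F : Finset (Fin 3 → ℤ)) (c : (Fin 3 → ℤ) → ℂ) (x : Pt) : ℝ :=
  ∑ K ∈ F, (c K * torusChar K x).re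

lemma continuous_reTrigPoly (F : Finset (Fin 3 → ℤ)) (c : (Fin 3 → ℤ) → ℂ) :
    Continuous (reTrigPoly F c) :=
  continuous_finsetSum _ fun K _ =>
    Complex.continuous_re.comp (continuous_const.mul (continuous_torusChar K))

lemma lpBlock_eq_reTrigPoly (k : ℤ) (u : Pt → Pt) (x : Pt) (i : Fin 3) :
    lpBlock k u x i = reTrigPoly (annulus k) (fcoef fun y => u y i) x := by
  rw [lpBlock, tsum_eq_sum (s := annulus k), reTrigPoly, Complex.re_sum]
  · refine Finset.sum_congr rfl fun K hK => ?_
    rw [if_pos (mem_annulus.mp hK), torusChar]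
  · intro K hK
    rw [if_neg fun h => hK (mem_annulus.mpr h)]

lemma pd_reTrigPoly (j : Fin 3) (F : Finset (Fin 3 → ℤ)) (c : (Fin 3 → ℤ) → ℂ) (x : Pt) :
    pd j (reTrigPoly F c) x = reTrigPoly F (fun K => Complex.I * K j * c K) x := by
  have hchar : ∀ K : Fin 3 → ℤ, HasFDerivAt (fun y : Pt => c K * torusChar K y)
      (c K • (torusChar K x • (Complex.I • ∑ i, (K i : ℂ) •
        (Complex.ofRealCLM.comp (ContinuousLinearMap.proj (R := ℝ) (φ := fun _ : Fin 3 => ℝ) i))))) x := fun K => by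
    unfold torusChar
    refine HasFDerivAt.const_mul (HasFDerivAt.cexp (HasFDerivAt.const_mul ?_ _)) _
    refine HasFDerivAt.fun_sum fun i _ => HasFDerivAt.const_mul ?_ _
    exact (Complex.ofRealCLM.comp (ContinuousLinearMap.proj (R := ℝ) (φ := fun _ : Fin 3 => ℝ) i)).hasFDerivAt
  have hre : HasFDerivAt (reTrigPoly F c) (∑ K ∈ F, Complex.reCLM.comp
      (c K • (torusChar K x • (Complex.I • ∑ i, (K i : ℂ) •
        (Complex.ofRealCLM.comp (ContinuousLinearMap.proj (R := ℝ) (φ := fun _ : Fin 3 => ℝ) i)))))) x := by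
    unfold reTrigPoly
    exact HasFDerivAt.fun_sum fun K _ => Complex.reCLM.hasFDerivAt.comp x (hchar K)
  rw [pd, hre.fderiv, reTrigPoly, sum_apply]
  refine Finset.sum_congr rfl fun K _ => ?_
  simp only [ContinuousLinearMap.comp_apply, smul_apply, sum_apply,
    ContinuousLinearMap.proj_apply, Complex.ofRealCLM_apply,
    smul_eq_mul, Complex.reCLM_apply]
  rw [Finset.sum_eq_single j (fun i _ hi => by simp [Pi.single_eq_of_ne hi]) (by simp)]
  rw [Pi.single_eq_same]
  congr 1
  push_cast
  ring

lemma integral_re_torusChar (d : ℂ) {K : Fin 3 → ℤ} (hK : K ≠ 0) :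
    ∫ x in box, (d * torusChar K x).re = 0 := by
  have h := integral_re (𝕜 := ℂ) (f := fun x => d * torusChar K x)
    (continuous_const.mul (continuous_torusChar K)).integrableOn_box
  rw [integral_const_mul, integral_torusChar_of_ne_zero hK, mul_zero] at h
  simpa using h

lemma integral_re_mul_re_mul_re (a b c : ℂ) {K L M : Fin 3 → ℤ} (h1 : K + L + M ≠ 0)
    (h2 : K + L + -M ≠ 0) (h3 : K + -L + M ≠ 0) (h4 : K + -L + -M ≠ 0) :
    ∫ x in box, (a * torusChar K x).re * (b * torusChar L x).re * (c * torusChar M x).re = 0 := by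
  have hpt : ∀ x, (a * torusChar K x).re * (b * torusChar L x).re * (c * torusChar M x).re =
      (((a * b * c / 4) * torusChar (K + L + M) x).re +
        ((a * b * (starRingEnd ℂ) c / 4) * torusChar (K + L + -M) x).re) +
      (((a * (starRingEnd ℂ) b * c / 4) * torusChar (K + -L + M) x).re +
        ((a * (starRingEnd ℂ) b * (starRingEnd ℂ) c / 4) * torusChar (K + -L + -M) x).re) :=
    fun x => by
      have key : ∀ z w v : ℂ, z.re * w.re * v.re = ((z * w * v / 4).re +
          (z * w * (starRingEnd ℂ) v / 4).re) + ((z * (starRingEnd ℂ) w * v / 4).re +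
          (z * (starRingEnd ℂ) w * (starRingEnd ℂ) v / 4).re) := fun z w v => by
        have h4 : ∀ q : ℂ, (q / 4).re = q.re / 4 := fun q => by
          simp
        simp only [h4, Complex.mul_re, Complex.mul_im, Complex.conj_re, Complex.conj_im]
        ring
      rw [key]
      simp only [torusChar_add, ← conj_torusChar, map_mul]
      congr 3 <;> ring
  have hint : ∀ (d : ℂ) (N : Fin 3 → ℤ),
      Integrable (fun x => (d * torusChar N x).re) (volume.restrict box) := fun d N =>
    (Complex.continuous_re.comp
      (continuous_const.mul (continuous_torusChar N))).integrableOn_box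
  have hint2 : ∀ (d d' : ℂ) (N N' : Fin 3 → ℤ),
      Integrable (fun x => (d * torusChar N x).re + (d' * torusChar N' x).re)
        (volume.restrict box) := fun d d' N N' => (hint d N).add (hint d' N')
  simp_rw [hpt]
  rw [integral_add (hint2 _ _ _ _) (hint2 _ _ _ _),
    integral_add (hint _ _) (hint _ _), integral_add (hint _ _) (hint _ _),
    integral_re_torusChar _ h1, integral_re_torusChar _ h2, integral_re_torusChar _ h3,
    integral_re_torusChar _ h4]
  simp

lemma integral_reTrigPoly_mul_mul {k m l : ℤ} (h : ¬ DyadicNear k m l)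
    (a b c : (Fin 3 → ℤ) → ℂ) :
    ∫ x in box, reTrigPoly (annulus l) a x * reTrigPoly (annulus m) b x *
      reTrigPoly (annulus k) c x = 0 := by
  have hc : ∀ (d : (Fin 3 → ℤ) → ℂ) N, Continuous fun x => (d N * torusChar N x).re := fun d N =>
    Complex.continuous_re.comp (continuous_const.mul (continuous_torusChar N))
  have hc3 : ∀ L M K, Continuous fun x =>
      (a L * torusChar L x).re * (b M * torusChar M x).re * (c K * torusChar K x).re :=
    fun L M K => ((hc a L).mul (hc b M)).mul (hc c K)
  have hexp : ∀ x, reTrigPoly (annulus l) a x * reTrigPoly (annulus m) b x *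
      reTrigPoly (annulus k) c x = ∑ L ∈ annulus l, ∑ M ∈ annulus m, ∑ K ∈ annulus k,
        (a L * torusChar L x).re * (b M * torusChar M x).re * (c K * torusChar K x).re :=
    fun x => by
      simp only [reTrigPoly]
      rw [Finset.sum_mul_sum, Finset.sum_mul]
      refine Finset.sum_congr rfl fun L _ => ?_
      rw [Finset.sum_mul]
      exact Finset.sum_congr rfl fun M _ => Finset.mul_sum _ _ _
  simp_rw [hexp]
  rw [integral_finsetSum _ fun L _ => (continuous_finsetSum _ fun M _ =>
    continuous_finsetSum _ fun K _ => hc3 L M K).integrableOn_box]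
  refine Finset.sum_eq_zero fun L hL => ?_
  rw [integral_finsetSum _ fun M _ => (continuous_finsetSum _ fun K _ =>
    hc3 L M K).integrableOn_box]
  refine Finset.sum_eq_zero fun M hM => ?_
  rw [integral_finsetSum _ fun K _ => (hc3 L M K).integrableOn_box]
  refine Finset.sum_eq_zero fun K hK => ?_
  rw [mem_annulus] at hL hM hK
  have hne : ∀ {M' K' : Fin 3 → ℤ}, inAnn m M' → inAnn k K' → L + M' + K' ≠ 0 :=
    fun hM' hK' => by
      have := add_add_ne_zero_of_not_dyadicNear hK' hL hM' h
      rwa [add_assoc, add_comm] at this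
  exact integral_re_mul_re_mul_re _ _ _ (hne hM hK) (hne hM (inAnn_neg hK))
    (hne (inAnn_neg hM) hK) (hne (inAnn_neg hM) (inAnn_neg hK))

lemma integral_stretching_eq_zero {k m l : ℤ} (h : ¬ DyadicNear k m l) (u ω : Pt → Pt) :
    ∫ x in box, dotP (conv (lpBlock l ω) (lpBlock m u) x) (lpBlock k ω x) = 0 := by
  have hpd : ∀ (i j : Fin 3) x, pd j (fun y => lpBlock m u y i) x =
      reTrigPoly (annulus m) (fun K => Complex.I * K j * fcoef (fun y => u y i) K) x :=
    fun i j x => by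
      rw [← pd_reTrigPoly]
      congr 1
      exact funext fun y => lpBlock_eq_reTrigPoly m u y i
  simp only [dotP, conv, hpd]
  simp only [lpBlock_eq_reTrigPoly, Finset.sum_mul]
  have hc : ∀ i j : Fin 3, Continuous fun x => reTrigPoly (annulus l) (fcoef fun y => ω y j) x *
      reTrigPoly (annulus m) (fun K => Complex.I * K j * fcoef (fun y => u y i) K) x *
      reTrigPoly (annulus k) (fcoef fun y => ω y i) x := fun i j =>
    ((continuous_reTrigPoly _ _).mul (continuous_reTrigPoly _ _)).mul (continuous_reTrigPoly _ _)
  rw [integral_finsetSum _ fun i _ => (continuous_finsetSum _ fun j _ => hc i j).integrableOn_box]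
  refine Finset.sum_eq_zero fun i _ => ?_
  rw [integral_finsetSum _ fun j _ => (hc i j).integrableOn_box]
  exact Finset.sum_eq_zero fun j _ => integral_reTrigPoly_mul_mul h _ _ _

lemma integral_sq_reTrigPoly_le (F : Finset (Fin 3 → ℤ)) (c : (Fin 3 → ℤ) → ℂ) :
    ∫ x in box, reTrigPoly F c x ^ 2 ≤ (2 * π) ^ 3 * ∑ K ∈ F, ‖c K‖ ^ 2 := by
  set P : Pt → ℂ := fun x => ∑ K ∈ F, c K * torusChar K x with hP
  have hPc : Continuous P :=
    continuous_finsetSum _ fun K _ => continuous_const.mul (continuous_torusChar K)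
  have hle : ∫ x in box, reTrigPoly F c x ^ 2 ≤ ∫ x in box, ‖P x‖ ^ 2 := by
    refine integral_mono ((continuous_reTrigPoly F c).pow 2).integrableOn_box
      (hPc.norm.pow 2).integrableOn_box fun x => ?_
    have : reTrigPoly F c x = (P x).re := by rw [hP, Complex.re_sum, reTrigPoly]
    simp only [this]
    exact sq_le_sq' (neg_le_of_abs_le (Complex.abs_re_le_norm _)) (Complex.re_le_norm _)
  refine hle.trans (le_of_eq ?_)
  have hexp : ∀ x, ((‖P x‖ ^ 2 : ℝ) : ℂ) = ∑ K ∈ F, ∑ L ∈ F,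
      (starRingEnd ℂ) (c K) * c L * ((starRingEnd ℂ) (torusChar K x) * torusChar L x) :=
    fun x => by
      rw [Complex.ofReal_pow, ← Complex.conj_mul', hP]
      simp only [map_sum, map_mul, Finset.sum_mul_sum]
      exact Finset.sum_congr rfl fun K _ => Finset.sum_congr rfl fun L _ => by ring
  have hc : ∀ K L : Fin 3 → ℤ, Continuous fun x =>
      (starRingEnd ℂ) (c K) * c L * ((starRingEnd ℂ) (torusChar K x) * torusChar L x) :=
    fun K L => continuous_const.mul
      ((Complex.continuous_conj.comp (continuous_torusChar K)).mul (continuous_torusChar L))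
  have hval : ((∫ x in box, ‖P x‖ ^ 2 : ℝ) : ℂ) =
      (((2 * π) ^ 3 * ∑ K ∈ F, ‖c K‖ ^ 2 : ℝ) : ℂ) := by
    rw [← integral_complex_ofReal]
    simp_rw [hexp]
    rw [integral_finsetSum _ fun K _ =>
      (continuous_finsetSum _ fun L _ => hc K L).integrableOn_box, Finset.mul_sum,
      Complex.ofReal_sum]
    refine Finset.sum_congr rfl fun K hK => ?_
    rw [integral_finsetSum _ fun L _ => (hc K L).integrableOn_box]
    simp_rw [integral_const_mul, integral_conj_torusChar_mul]
    rw [Finset.sum_eq_single_of_mem K hK fun L _ hL => by rw [if_neg hL.symm, mul_zero],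
      if_pos rfl, Complex.conj_mul']
    push_cast
    ring
  exact_mod_cast hval

/-- The sum over the components of the squared Fourier coefficients. -/
def fcoefSq (u : Pt → Pt) (K : Fin 3 → ℤ) : ℝ := ∑ i, ‖fcoef (fun x => u x i) K‖ ^ 2

lemma fcoefSq_nonneg (u : Pt → Pt) (K : Fin 3 → ℤ) : 0 ≤ fcoefSq u K :=
  Finset.sum_nonneg fun _ _ => sq_nonneg _

lemma l2N_lpBlock_sq_le (k : ℤ) (u : Pt → Pt) :
    l2N (lpBlock k u) ^ 2 ≤ (2 * π) ^ 3 * ∑ K ∈ annulus k, fcoefSq u K := by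
  have h0 : 0 ≤ l2Sq (lpBlock k u) :=
    integral_nonneg fun x => Finset.sum_nonneg fun _ _ => sq_nonneg _
  rw [l2N, Real.sq_sqrt h0, l2Sq]
  simp only [lpBlock_eq_reTrigPoly, fcoefSq]
  have hc : ∀ i : Fin 3, Continuous fun x =>
      reTrigPoly (annulus k) (fcoef fun y => u y i) x ^ 2 :=
    fun i => (continuous_reTrigPoly _ _).pow 2
  rw [integral_finsetSum _ fun i _ => (hc i).integrableOn_box,
    Finset.sum_comm, Finset.mul_sum]
  exact Finset.sum_le_sum fun i _ => integral_sq_reTrigPoly_le _ _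

lemma fcoefSq_curl_le {u ω : Pt → Pt} (h : fcurlRel u ω) (K : Fin 3 → ℤ) :
    fcoefSq ω K ≤ 2 * nsq K * fcoefSq u K := by
  have key : ∀ (a b : ℤ) (z w : ℂ),
      ‖Complex.I * ((a : ℂ) * z - b * w)‖ ^ 2 ≤
        2 * ((a : ℝ) ^ 2 * ‖z‖ ^ 2 + (b : ℝ) ^ 2 * ‖w‖ ^ 2) := fun a b z w => by
    rw [norm_mul, Complex.norm_I, one_mul]
    have h1 := norm_sub_le ((a : ℂ) * z) (b * w)
    rw [norm_mul, norm_mul, Complex.norm_intCast, Complex.norm_intCast] at h1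
    have h2 := pow_le_pow_left₀ (norm_nonneg _) h1 2
    have ha := sq_abs (a : ℝ)
    have hb := sq_abs (b : ℝ)
    rw [← ha, ← hb]
    nlinarith [sq_nonneg (|(a : ℝ)| * ‖z‖ - |(b : ℝ)| * ‖w‖)]
  obtain ⟨h0, h1, h2⟩ := h K
  simp only [fcoefSq, nsq, Fin.sum_univ_three]
  rw [h0, h1, h2]
  have k0 := key (K 1) (K 2) (fcoef (fun x => u x 2) K) (fcoef (fun x => u x 1) K)
  have k1 := key (K 2) (K 0) (fcoef (fun x => u x 0) K) (fcoef (fun x => u x 2) K)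
  have k2 := key (K 0) (K 1) (fcoef (fun x => u x 1) K) (fcoef (fun x => u x 0) K)
  have p : ∀ i j : Fin 3, 0 ≤ (K i : ℝ) ^ 2 * ‖fcoef (fun x => u x j) K‖ ^ 2 :=
    fun i j => by positivity
  linarith [p 0 0, p 1 1, p 2 2]

lemma summable_fcoefSq_of_fcurlRel {u ω : Pt → Pt} (hu : MemHs 2 u) (h : fcurlRel u ω) :
    Summable (fcoefSq ω) := by
  refine Summable.of_nonneg_of_le (fcoefSq_nonneg ω) (fun K => ?_) (hu.2.2.mul_left 2)
  refine (fcoefSq_curl_le h K).trans ?_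
  have h1 := nsq_nonneg K
  have h2 : nsq K ≤ (1 + nsq K) ^ (2 : ℝ) := by
    rw [Real.rpow_two]
    nlinarith
  rw [mul_assoc]
  exact mul_le_mul_of_nonneg_left (mul_le_mul_of_nonneg_right h2 (fcoefSq_nonneg u K)) two_pos.le

lemma l2Sq_eq_tsum {ω : Pt → Pt} (hω : ∀ i, IntegrableOn (fun x => ω x i) box)
    (hs : Summable (fcoefSq ω)) : l2Sq ω = (2 * π) ^ 3 * ∑' K, fcoefSq ω K := by
  have hsi : ∀ i, Summable fun K => ‖fcoef (fun x => ω x i) K‖ ^ 2 := fun i =>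
    Summable.of_nonneg_of_le (fun _ => sq_nonneg _)
      (fun K => Finset.single_le_sum (f := fun i => ‖fcoef (fun x => ω x i) K‖ ^ 2)
        (fun _ _ => sq_nonneg _) (Finset.mem_univ i)) hs
  have hP := fun i => parseval_box (hω i) (hsi i)
  rw [l2Sq, integral_finsetSum _ fun i _ => (hP i).1]
  simp only [fcoefSq]
  rw [Summable.tsum_finsetSum fun i _ => hsi i, Finset.mul_sum]
  exact Finset.sum_congr rfl fun i _ => (hP i).2

lemma inAnn_unique {k m : ℤ} {K : Fin 3 → ℤ} (hk : inAnn k K) (hm : inAnn m K) : k = m := by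
  have key : ∀ {k m : ℤ}, inAnn k K → inAnn m K → ¬ k < m := fun {k m} hk hm hlt => by
    have h1 : (2 : ℝ) ^ k * 2 ≤ (2 : ℝ) ^ m := by
      rw [← zpow_add_one₀ two_ne_zero]
      exact zpow_le_zpow_right₀ one_le_two hlt
    have h2 := pow_le_pow_left₀ (by positivity) h1 2
    have h3 := hk.2
    have h4 := hm.1
    linarith
  exact le_antisymm (not_lt.mp (key hm hk)) (not_lt.mp (key hk hm))

lemma sum_sum_annulus_le {e : (Fin 3 → ℤ) → ℝ} (h0 : ∀ K, 0 ≤ e K) (hs : Summable e)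
    (G : Finset ℤ) : ∑ k ∈ G, ∑ K ∈ annulus k, e K ≤ ∑' K, e K := by
  rw [← Finset.sum_biUnion fun k _ m _ hkm => Finset.disjoint_left.mpr fun K hk hm =>
    hkm (inAnn_unique (mem_annulus.mp hk) (mem_annulus.mp hm))]
  exact hs.sum_le_tsum _ fun K _ => h0 K

lemma rpow_le_of_comparable {x y c : ℝ} (s : ℝ) (hx : 0 < x) (hy : 0 < y) (hc : 0 < c)
    (hxy : x ≤ c * y) (hyx : y ≤ c * x) : x ^ s ≤ c ^ |s| * y ^ s := by
  rcases le_total 0 s with hs | hs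
  · rw [abs_of_nonneg hs, ← Real.mul_rpow hc.le hy.le]
    exact Real.rpow_le_rpow hx.le hxy hs
  · have h1 : (c * x) ^ s ≤ y ^ s := Real.rpow_le_rpow_of_nonpos hy hyx hs
    rw [Real.mul_rpow hc.le hx.le] at h1
    have h2 := mul_le_mul_of_nonneg_left h1 (Real.rpow_nonneg hc.le (-s))
    rwa [← mul_assoc, ← Real.rpow_add hc, neg_add_cancel, Real.rpow_zero, one_mul,
      ← abs_of_nonpos hs] at h2

lemma sq_two_rpow_le_of_inAnn (s : ℝ) {k : ℤ} (hk : -1 ≤ k) {K : Fin 3 → ℤ} (hK : inAnn k K) :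
    ((2 : ℝ) ^ ((k : ℝ) * s)) ^ 2 ≤ 6 ^ |s| * (1 + nsq K) ^ s := by
  have h1 : (2 : ℝ)⁻¹ ≤ (2 : ℝ) ^ k := by
    rw [← zpow_neg_one]
    exact zpow_le_zpow_right₀ one_le_two hk
  have h2 : ((2 : ℝ) ^ ((k : ℝ) * s)) ^ 2 = (((2 : ℝ) ^ k) ^ 2) ^ s := by
    rw [Real.rpow_mul two_pos.le, Real.rpow_intCast, ← Real.rpow_natCast, ← Real.rpow_natCast,
      ← Real.rpow_mul (by positivity), ← Real.rpow_mul (by positivity), mul_comm]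
  have h3 := hK.1
  have h4 := hK.2
  rw [h2]
  exact rpow_le_of_comparable s (by positivity) (by linarith [nsq_nonneg K]) (by norm_num)
    (by nlinarith) (by nlinarith)

lemma l2Sq_nonneg (u : Pt → Pt) : 0 ≤ l2Sq u :=
  integral_nonneg fun _ => Finset.sum_nonneg fun _ _ => sq_nonneg _

lemma sobSq_nonneg (s : ℝ) (u : Pt → Pt) : 0 ≤ sobSq s u :=
  tsum_nonneg fun K => mul_nonneg (Real.rpow_nonneg (by linarith [nsq_nonneg K]) _)
    (fcoefSq_nonneg u K)

lemma sum_sq_l2N_lpBlock_le {ω : Pt → Pt} (hω : ∀ i, IntegrableOn (fun x => ω x i) box)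
    (hs : Summable (fcoefSq ω)) (G : Finset ℤ) :
    ∑ k ∈ G, l2N (lpBlock k ω) ^ 2 ≤ l2Sq ω := by
  rw [l2Sq_eq_tsum hω hs]
  refine (Finset.sum_le_sum fun k _ => l2N_lpBlock_sq_le k ω).trans ?_
  rw [← Finset.mul_sum]
  exact mul_le_mul_of_nonneg_left (sum_sum_annulus_le (fcoefSq_nonneg ω) hs G) (by positivity)

lemma sum_sq_weighted_l2N_lpBlock_le {s : ℝ} {ω : Pt → Pt} (hω : MemHs s ω) {G : Finset ℤ}
    (hG : ∀ k ∈ G, -1 ≤ k) :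
    ∑ k ∈ G, ((2 : ℝ) ^ ((k : ℝ) * s) * l2N (lpBlock k ω)) ^ 2 ≤
      (2 * π) ^ 3 * 6 ^ |s| * sobSq s ω := by
  have h : ∀ k ∈ G, ((2 : ℝ) ^ ((k : ℝ) * s) * l2N (lpBlock k ω)) ^ 2 ≤
      (2 * π) ^ 3 * 6 ^ |s| * ∑ K ∈ annulus k, (1 + nsq K) ^ s * fcoefSq ω K := fun k hk => by
    rw [mul_pow]
    refine (mul_le_mul_of_nonneg_left (l2N_lpBlock_sq_le k ω) (sq_nonneg _)).trans ?_
    rw [mul_left_comm, mul_assoc]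
    refine mul_le_mul_of_nonneg_left ?_ (by positivity)
    rw [Finset.mul_sum, Finset.mul_sum]
    refine Finset.sum_le_sum fun K hK => ?_
    rw [← mul_assoc]
    exact mul_le_mul_of_nonneg_right
      (sq_two_rpow_le_of_inAnn s (hG k hk) (mem_annulus.mp hK)) (fcoefSq_nonneg ω K)
  refine (Finset.sum_le_sum h).trans ?_
  rw [← Finset.mul_sum]
  exact mul_le_mul_of_nonneg_left (sum_sum_annulus_le
    (fun K => mul_nonneg (Real.rpow_nonneg (by linarith [nsq_nonneg K]) _) (fcoefSq_nonneg ω K))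
    hω.2.2 G) (by positivity)

/-- paraproduct estimate for the vortex stretching term.
The vortex stretching term `∫(ω·∇)u·ω = Σ_{k,m,ℓ≥-1} ∫(ω^ℓ·∇)u^m·ω^k` is
bounded by `C_δ ‖ω‖_{H^{β+δ}} ‖ω‖²_{L²}`, with `C_δ` depending only on
`δ`, `β` and `C`. -/
theorem statement2 (β δ C : ℝ) (hδ : 0 < δ) (hC : 0 < C) :
    ∃ Cd > (0 : ℝ), ∀ u ω : Pt → Pt,
      MemHs 2 u → fMeanZero u → fDivFree u →
      MemHs (β + δ) ω → fcurlRel u ω →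
      (∀ k m ℓ : ℤ, -1 ≤ k → -1 ≤ m → -1 ≤ ℓ →
        (∫ x in box, dotP (conv (lpBlock ℓ ω) (lpBlock m u) x) (lpBlock k ω x)) ≤
          C * (2 : ℝ) ^ ((k : ℝ) * β) * l2N (lpBlock ℓ ω) * l2N (lpBlock m ω) *
            l2N (lpBlock k ω)) →
      (∑' p : {k : ℤ // -1 ≤ k} × {m : ℤ // -1 ≤ m} × {l : ℤ // -1 ≤ l},
          ∫ x in box, dotP (conv (lpBlock p.2.2.1 ω) (lpBlock p.2.1.1 u) x)
            (lpBlock p.1.1 ω x)) ≤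
        Cd * sobNorm (β + δ) ω * l2Sq ω := by
  obtain ⟨D, hD, hsum⟩ := exists_trilinear_dyadic_sum_le β hδ
  set B : ℝ := (2 * π) ^ 3 * 6 ^ |β + δ| with hB
  have hB0 : 0 < B := by positivity
  refine ⟨C * (D * √B), by positivity, fun u ω hu _ _ hω hcurl hbound => ?_⟩
  have hS0 : 0 ≤ sobNorm (β + δ) ω := Real.sqrt_nonneg _
  have hR0 : 0 ≤ C * (D * √B) * sobNorm (β + δ) ω * l2Sq ω :=
    mul_nonneg (by positivity) (l2Sq_nonneg ω)
  set a : ℤ → ℝ := fun k => l2N (lpBlock k ω) with ha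
  have ha0 : ∀ k, 0 ≤ a k := fun k => Real.sqrt_nonneg _
  set T : ℤ × ℤ × ℤ → ℝ := fun q => C *
    if DyadicNear q.1 q.2.1 q.2.2 then
      (2 : ℝ) ^ ((q.1 : ℝ) * β) * a q.2.2 * a q.2.1 * a q.1 else 0 with hT
  have hT0 : ∀ q, 0 ≤ T q := fun q => by
    refine mul_nonneg hC.le ?_
    split_ifs
    · exact mul_nonneg (mul_nonneg (mul_nonneg (by positivity) (ha0 _)) (ha0 _)) (ha0 _)
    · exact le_rfl
  set φ : {k : ℤ // -1 ≤ k} × {m : ℤ // -1 ≤ m} × {l : ℤ // -1 ≤ l} → ℤ × ℤ × ℤ :=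
    fun p => (p.1.1, p.2.1.1, p.2.2.1) with hφ
  have hφi : Function.Injective φ := fun p q h => by
    simp only [hφ, Prod.mk.injEq] at h
    exact Prod.ext (Subtype.ext h.1) (Prod.ext (Subtype.ext h.2.1) (Subtype.ext h.2.2))
  by_cases hsm : Summable fun p : {k : ℤ // -1 ≤ k} × {m : ℤ // -1 ≤ m} × {l : ℤ // -1 ≤ l} =>
      ∫ x in box, dotP (conv (lpBlock p.2.2.1 ω) (lpBlock p.2.1.1 u) x) (lpBlock p.1.1 ω x)
  swap
  · rw [tsum_eq_zero_of_not_summable hsm]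
    exact hR0
  refine hsm.tsum_le_of_sum_le fun s => ?_
  have hterm : ∀ p ∈ s, (∫ x in box, dotP (conv (lpBlock p.2.2.1 ω) (lpBlock p.2.1.1 u) x)
      (lpBlock p.1.1 ω x)) ≤ T (φ p) := fun p _ => by
    by_cases hn : DyadicNear p.1.1 p.2.1.1 p.2.2.1
    · simp only [hT, hφ, if_pos hn]
      refine (hbound _ _ _ p.1.2 p.2.1.2 p.2.2.2).trans (le_of_eq ?_)
      ring
    · rw [integral_stretching_eq_zero hn]
      exact hT0 _
  set G : Finset ℤ := s.image (fun p => p.1.1) ∪ s.image (fun p => p.2.1.1) ∪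
    s.image (fun p => p.2.2.1) with hG
  have hG1 : ∀ k ∈ G, -1 ≤ k := fun k hk => by
    simp only [hG, Finset.mem_union, Finset.mem_image] at hk
    rcases hk with (⟨p, _, rfl⟩ | ⟨p, _, rfl⟩) | ⟨p, _, rfl⟩
    exacts [p.1.2, p.2.1.2, p.2.2.2]
  have hsub : s.image φ ⊆ G ×ˢ G ×ˢ G := fun q hq => by
    obtain ⟨p, hp, rfl⟩ := Finset.mem_image.mp hq
    simp only [Finset.mem_product, hG, Finset.mem_union]
    exact ⟨.inl (.inl (Finset.mem_image_of_mem (fun p => p.1.1) hp)),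
      .inl (.inr (Finset.mem_image_of_mem (fun p => p.2.1.1) hp)),
      .inr (Finset.mem_image_of_mem (fun p => p.2.2.1) hp)⟩
  have hmain := hsum a (l2Sq ω) (√B * sobNorm (β + δ) ω) G ha0 (by positivity) hG1
    (sum_sq_l2N_lpBlock_le hω.2.1 (summable_fcoefSq_of_fcurlRel hu hcurl) G)
    (by
      rw [mul_pow, Real.sq_sqrt hB0.le, sobNorm, Real.sq_sqrt (sobSq_nonneg _ _)]
      exact sum_sq_weighted_l2N_lpBlock_le hω hG1)
  calc _ ≤ ∑ p ∈ s, T (φ p) := Finset.sum_le_sum hterm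
    _ = ∑ q ∈ s.image φ, T q := (Finset.sum_image fun p _ q _ h => hφi h).symm
    _ ≤ ∑ q ∈ G ×ˢ G ×ˢ G, T q := Finset.sum_le_sum_of_subset_of_nonneg hsub fun q _ _ => hT0 q
    _ = C * ∑ k ∈ G, ∑ m ∈ G, ∑ l ∈ G, (if DyadicNear k m l then
          (2 : ℝ) ^ ((k : ℝ) * β) * a l * a m * a k else 0) := by
      simp only [hT, Finset.sum_product, Finset.mul_sum]
    _ ≤ C * (D * (√B * sobNorm (β + δ) ω) * l2Sq ω) := mul_le_mul_of_nonneg_left hmain hC.le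
    _ = _ := by ring
end
end

section
/- Let β ∈ ℝ and δ > 0. There exists a constant C_{β,δ} > 0 such that for every nonnegative sequence (a_k)_{k ∈ ℤ_{≥−1}} one has Σ_{k≥−1} 2^{βk} a_k ( Σ_{ℓ=−1}^{k} a_ℓ ) ≤ C_{β,δ} · ( Σ_{k≥−1} 2^{2(β+δ)k} a_k² )^{1/2} · ( Σ_{k≥−1} a_k² )^{1/2}. -/
open scoped ENNReal

/-- Cauchy–Schwarz for arbitrary families of extended nonnegative reals. -/
theorem ENNReal.tsum_mul_le_sqrt_mul_sqrt {ι : Type*} (f g : ι → ℝ≥0∞) :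
    ∑' i, f i * g i ≤
      (∑' i, f i ^ 2) ^ ((1 : ℝ) / 2) * (∑' i, g i ^ 2) ^ ((1 : ℝ) / 2) := by
  refine ENNReal.summable.tsum_le_of_sum_le fun s => ?_
  have h := ENNReal.inner_le_Lp_mul_Lq s f g Real.HolderConjugate.two_two
  simp only [ENNReal.rpow_two] at h
  refine h.trans ?_
  gcongr <;> exact ENNReal.sum_le_tsum s

theorem summable_sq_mul_two_rpow_neg {δ : ℝ} (hδ : 0 < δ) :
    Summable fun n : ℕ => (((n : ℝ) + 1) * (2 : ℝ) ^ (-δ * ((n : ℝ) - 1))) ^ 2 := by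
  have hr : ‖(2 : ℝ) ^ (-2 * δ)‖ < 1 := by
    rw [Real.norm_of_nonneg (by positivity)]
    exact Real.rpow_lt_one_of_one_lt_of_neg one_lt_two (by linarith)
  have h : Summable fun n : ℕ => ((n + 1 : ℕ) : ℝ) ^ 2 * ((2 : ℝ) ^ (-2 * δ)) ^ (n + 1) :=
    (summable_nat_add_iff (f := fun n : ℕ => (n : ℝ) ^ 2 * ((2 : ℝ) ^ (-2 * δ)) ^ n) 1).2
      (summable_pow_mul_geometric_of_norm_lt_one 2 hr)
  refine (h.mul_right ((2 : ℝ) ^ (4 * δ))).congr fun n => ?_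
  have hpow : ((2 : ℝ) ^ (-2 * δ)) ^ (n + 1) * (2 : ℝ) ^ (4 * δ) =
      ((2 : ℝ) ^ (-δ * ((n : ℝ) - 1))) ^ 2 := by
    rw [← Real.rpow_mul_natCast zero_le_two, ← Real.rpow_mul_natCast zero_le_two,
      ← Real.rpow_add zero_lt_two]
    congr 1
    push_cast
    ring
  rw [mul_assoc, hpow, mul_pow, Nat.cast_add_one]

theorem tsum_sq_mul_two_rpow_neg_ne_top {δ : ℝ} (hδ : 0 < δ) :
    ∑' k : {k : ℤ // -1 ≤ k},
      ((2 : ℝ≥0∞) ^ (-δ * ((k : ℤ) : ℝ)) * ((Finset.Icc (-1) (k : ℤ)).card : ℝ≥0∞)) ^ 2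
        ≠ ∞ := by
  refine ne_top_of_le_ne_top (summable_sq_mul_two_rpow_neg hδ).tsum_ofReal_ne_top ?_
  have hinj : Function.Injective fun k : {k : ℤ // -1 ≤ k} => ((k : ℤ) + 1).toNat := by
    rintro ⟨k, hk⟩ ⟨l, hl⟩ h
    simp only [Subtype.mk.injEq] at h ⊢
    omega
  refine le_trans (ENNReal.tsum_le_tsum fun k => ?_)
    (ENNReal.tsum_comp_le_tsum_of_injective hinj _)
  obtain ⟨k, hk⟩ := k
  obtain ⟨n, hn⟩ : ∃ n : ℕ, k = n - 1 := ⟨(k + 1).toNat, by omega⟩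
  subst hn
  have hcard : (Finset.Icc (-1) ((n : ℤ) - 1)).card = n + 1 := by
    rw [Int.card_Icc]; omega
  have hnat : ((n : ℤ) - 1 + 1).toNat = n := by omega
  simp only [hcard, hnat]
  rw [ENNReal.ofReal_pow (by positivity), ENNReal.ofReal_mul (by positivity),
    ← ENNReal.ofReal_rpow_of_pos zero_lt_two, mul_comm]
  push_cast
  rw [ENNReal.ofReal_add (by positivity) zero_le_one]
  simp

/-- sequence-level estimate for the low-high paraproduct
contributions `D₁`, `D₂`:
`Σ_{k≥-1} 2^{βk} a_k (Σ_{ℓ=-1}^{k} a_ℓ)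
  ≤ C_{β,δ} (Σ_{k≥-1} 2^{2(β+δ)k} a_k²)^{1/2} (Σ_{k≥-1} a_k²)^{1/2}`,
interpreted in `[0,∞]`. -/
theorem statement3 (β δ : ℝ) (hδ : 0 < δ) :
    ∃ C : ℝ, 0 < C ∧ ∀ a : ℤ → ℝ≥0∞,
      (∑' k : {k : ℤ // -1 ≤ k},
          (2 : ℝ≥0∞) ^ (β * ((k : ℤ) : ℝ)) * a k * ∑ ℓ ∈ Finset.Icc (-1) (k : ℤ), a ℓ) ≤
        ENNReal.ofReal C *
          (∑' k : {k : ℤ // -1 ≤ k},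
              (2 : ℝ≥0∞) ^ (2 * (β + δ) * ((k : ℤ) : ℝ)) * a k ^ 2) ^ ((1 : ℝ) / 2) *
          (∑' k : {k : ℤ // -1 ≤ k}, a k ^ 2) ^ ((1 : ℝ) / 2) := by
  set w : {k : ℤ // -1 ≤ k} → ℝ≥0∞ := fun k =>
    (2 : ℝ≥0∞) ^ (-δ * ((k : ℤ) : ℝ)) * ((Finset.Icc (-1) (k : ℤ)).card : ℝ≥0∞)
  set W : ℝ≥0∞ := (∑' k, w k ^ 2) ^ ((1 : ℝ) / 2)
  have hWtop : W ≠ ∞ :=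
    ENNReal.rpow_ne_top_of_nonneg (by norm_num) (tsum_sq_mul_two_rpow_neg_ne_top hδ)
  refine ⟨W.toReal + 1, by positivity, fun a => ?_⟩
  have hWC : W ≤ ENNReal.ofReal (W.toReal + 1) :=
    (ENNReal.le_ofReal_iff_toReal_le hWtop (by positivity)).2 (by linarith)
  set B : ℝ≥0∞ := (∑' k : {k : ℤ // -1 ≤ k}, a k ^ 2) ^ ((1 : ℝ) / 2)
  have haB (l : ℤ) (hl : -1 ≤ l) : a l ≤ B := by
    have h := ENNReal.rpow_le_rpow
      (ENNReal.le_tsum (f := fun k : {k : ℤ // -1 ≤ k} => a k ^ 2) ⟨l, hl⟩)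
      (by norm_num : (0 : ℝ) ≤ 1 / 2)
    rwa [← ENNReal.rpow_two, ← ENNReal.rpow_mul, mul_one_div_cancel two_ne_zero,
      ENNReal.rpow_one] at h
  set f : {k : ℤ // -1 ≤ k} → ℝ≥0∞ := fun k =>
    (2 : ℝ≥0∞) ^ ((β + δ) * ((k : ℤ) : ℝ)) * a k
  have hf (k : {k : ℤ // -1 ≤ k}) :
      (2 : ℝ≥0∞) ^ (2 * (β + δ) * ((k : ℤ) : ℝ)) * a k ^ 2 = f k ^ 2 := by
    simp only [f]
    rw [mul_pow, ← ENNReal.rpow_two ((2 : ℝ≥0∞) ^ (_ : ℝ)), ← ENNReal.rpow_mul]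
    ring_nf
  simp only [hf]
  calc
    _ ≤ ∑' k, f k * w k * B := by
      refine ENNReal.tsum_le_tsum fun k => ?_
      have hsum : ∑ l ∈ Finset.Icc (-1) (k : ℤ), a l ≤
          ((Finset.Icc (-1) (k : ℤ)).card : ℝ≥0∞) * B := by
        rw [← nsmul_eq_mul]
        exact Finset.sum_le_card_nsmul _ _ _ fun l hl => haB l (Finset.mem_Icc.1 hl).1
      have hpow : (2 : ℝ≥0∞) ^ (β * ((k : ℤ) : ℝ)) =
          2 ^ ((β + δ) * ((k : ℤ) : ℝ)) * 2 ^ (-δ * ((k : ℤ) : ℝ)) := by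
        rw [← ENNReal.rpow_add _ _ two_ne_zero ENNReal.ofNat_ne_top]
        ring_nf
      refine (mul_le_mul_right hsum _).trans_eq ?_
      rw [hpow]
      simp only [f, w]
      ring
    _ = (∑' k, f k * w k) * B := ENNReal.tsum_mul_right
    _ ≤ ((∑' k, f k ^ 2) ^ ((1 : ℝ) / 2) * W) * B := by
      gcongr
      exact ENNReal.tsum_mul_le_sqrt_mul_sqrt f w
    _ ≤ _ := by
      rw [mul_comm _ W]
      gcongr
end

section
/- Let β ∈ ℝ and δ > 0. There exists a constant C_{β,δ} > 0 such that for every nonnegative sequence (a_k)_{k ∈ ℤ_{≥−1}} (with the convention a_{−2} = 0) one has Σ_{k≥−1} 2^{βk} a_k ( Σ_{ℓ ≥ max(k−1,−1)} a_ℓ (a_{ℓ−1} + a_ℓ + a_{ℓ+1}) ) ≤ C_{β,δ} · ( Σ_{k≥−1} 2^{2(β+δ)k} a_k² )^{1/2} · ( Σ_{k≥−1} a_k² ). -/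
open scoped ENNReal

/-- The weights `2^(-δk)`, `k ≥ -1`, are summable. -/
lemma tsum_two_rpow_neg_mul_ne_top {δ : ℝ} (hδ : 0 < δ) :
    ∑' k : {k : ℤ // -1 ≤ k}, (2 : ℝ≥0∞) ^ (-δ * ((k : ℤ) : ℝ)) ≠ ∞ := by
  let e : ℕ ≃ {k : ℤ // -1 ≤ k} :=
    { toFun := fun n => ⟨(n : ℤ) - 1, by lia⟩
      invFun := fun k => ((k : ℤ) + 1).toNat
      left_inv := fun n => by simp
      right_inv := fun ⟨k, hk⟩ => by ext; simp; lia }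
  have hterm (n : ℕ) :
      (2 : ℝ≥0∞) ^ (-δ * (((e n : {k : ℤ // -1 ≤ k}) : ℤ) : ℝ)) =
        2 ^ δ * ((2 : ℝ≥0∞) ^ (-δ)) ^ n := by
    rw [← ENNReal.rpow_natCast, ← ENNReal.rpow_mul,
      ← ENNReal.rpow_add _ _ two_ne_zero ENNReal.ofNat_ne_top]
    congr 1
    simp only [e, Equiv.coe_fn_mk]
    push_cast
    ring
  rw [← e.tsum_eq, tsum_congr hterm, ENNReal.tsum_mul_left, ENNReal.tsum_geometric]
  refine ENNReal.mul_ne_top (ENNReal.rpow_ne_top_of_nonneg hδ.le ENNReal.ofNat_ne_top) ?_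
  rw [ENNReal.inv_ne_top, ← pos_iff_ne_zero, tsub_pos_iff_lt]
  exact ENNReal.rpow_lt_one_of_one_lt_of_neg ENNReal.one_lt_two (neg_lt_zero.mpr hδ)

lemma ENNReal.mul_le_sq_add_sq (x y : ℝ≥0∞) : x * y ≤ x ^ 2 + y ^ 2 := by
  rcases le_total x y with h | h
  · calc x * y ≤ y * y := by gcongr
      _ = y ^ 2 := (sq y).symm
      _ ≤ x ^ 2 + y ^ 2 := le_add_self
  · calc x * y ≤ x * x := by gcongr
      _ = x ^ 2 := (sq x).symm
      _ ≤ x ^ 2 + y ^ 2 := le_self_add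

/-- The sum of neighbouring products over any tail is controlled by the sum of squares. -/
lemma tsum_mul_neighbours_le {a : ℤ → ℝ≥0∞} (ha : a (-2) = 0) {m : ℤ} (hm : -1 ≤ m) :
    ∑' ℓ : {ℓ : ℤ // m ≤ ℓ}, a ℓ * (a ((ℓ : ℤ) - 1) + a ℓ + a ((ℓ : ℤ) + 1)) ≤
      5 * ∑' k : {k : ℤ // -1 ≤ k}, a k ^ 2 := by
  let b : ℤ → ℝ≥0∞ := Set.indicator {k : ℤ | -1 ≤ k} fun k => a k ^ 2
  have hb : ∑' k : {k : ℤ // -1 ≤ k}, a k ^ 2 = ∑' k, b k :=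
    tsum_subtype {k : ℤ | -1 ≤ k} fun k => a k ^ 2
  have hab (k : ℤ) (hk : -2 ≤ k) : a k ^ 2 = b k := by
    rcases hk.eq_or_lt with rfl | hk
    · simp [b, ha]
    · simp [b, show -1 ≤ k by lia]
  calc ∑' ℓ : {ℓ : ℤ // m ≤ ℓ}, a ℓ * (a ((ℓ : ℤ) - 1) + a ℓ + a ((ℓ : ℤ) + 1))
      ≤ ∑' ℓ : {ℓ : ℤ // m ≤ ℓ}, (3 * b ℓ + b ((ℓ : ℤ) - 1) + b ((ℓ : ℤ) + 1)) := by
        refine ENNReal.tsum_le_tsum fun ⟨ℓ, hℓ⟩ => ?_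
        dsimp only
        rw [← hab ℓ (by lia), ← hab (ℓ - 1) (by lia), ← hab (ℓ + 1) (by lia)]
        calc a ℓ * (a (ℓ - 1) + a ℓ + a (ℓ + 1))
            = a ℓ * a (ℓ - 1) + a ℓ ^ 2 + a ℓ * a (ℓ + 1) := by ring
          _ ≤ (a ℓ ^ 2 + a (ℓ - 1) ^ 2) + a ℓ ^ 2 + (a ℓ ^ 2 + a (ℓ + 1) ^ 2) := by
            gcongr <;> exact ENNReal.mul_le_sq_add_sq _ _
          _ = 3 * a ℓ ^ 2 + a (ℓ - 1) ^ 2 + a (ℓ + 1) ^ 2 := by ring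
    _ ≤ ∑' ℓ : ℤ, (3 * b ℓ + b (ℓ - 1) + b (ℓ + 1)) :=
        ENNReal.tsum_comp_le_tsum_of_injective Subtype.val_injective
          fun ℓ : ℤ => 3 * b ℓ + b (ℓ - 1) + b (ℓ + 1)
    _ = 5 * ∑' k : {k : ℤ // -1 ≤ k}, a k ^ 2 := by
        have hsub : ∑' ℓ, b (ℓ - 1) = ∑' ℓ, b ℓ := (Equiv.subRight (1 : ℤ)).tsum_eq b
        have hadd : ∑' ℓ, b (ℓ + 1) = ∑' ℓ, b ℓ := (Equiv.addRight (1 : ℤ)).tsum_eq b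
        rw [ENNReal.tsum_add, ENNReal.tsum_add, ENNReal.tsum_mul_left, hsub, hadd, hb]
        ring

/-- Each term of a weighted `ℓ²` sequence is bounded by its norm, so a loss of `2^(δk)` in the
weight suffices to sum the sequence. -/
lemma tsum_two_rpow_mul_le (β δ : ℝ) (a : ℤ → ℝ≥0∞) :
    ∑' k : {k : ℤ // -1 ≤ k}, (2 : ℝ≥0∞) ^ (β * ((k : ℤ) : ℝ)) * a k ≤
      (∑' k : {k : ℤ // -1 ≤ k}, (2 : ℝ≥0∞) ^ (-δ * ((k : ℤ) : ℝ))) *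
        (∑' k : {k : ℤ // -1 ≤ k},
          (2 : ℝ≥0∞) ^ (2 * (β + δ) * ((k : ℤ) : ℝ)) * a k ^ 2) ^ ((1 : ℝ) / 2) := by
  rw [← ENNReal.tsum_mul_right]
  refine ENNReal.tsum_le_tsum fun k => ?_
  have hsq : ((2 : ℝ≥0∞) ^ ((β + δ) * ((k : ℤ) : ℝ)) * a k) ^ (2 : ℝ) =
      (2 : ℝ≥0∞) ^ (2 * (β + δ) * ((k : ℤ) : ℝ)) * a k ^ 2 := by
    rw [ENNReal.mul_rpow_of_nonneg _ _ zero_le_two, ← ENNReal.rpow_mul, ENNReal.rpow_two]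
    ring_nf
  calc (2 : ℝ≥0∞) ^ (β * ((k : ℤ) : ℝ)) * a k
      = (2 : ℝ≥0∞) ^ (-δ * ((k : ℤ) : ℝ)) *
          ((2 : ℝ≥0∞) ^ ((β + δ) * ((k : ℤ) : ℝ)) * a k) := by
        rw [← mul_assoc, ← ENNReal.rpow_add _ _ two_ne_zero ENNReal.ofNat_ne_top]
        ring_nf
    _ ≤ _ := by
        gcongr
        rw [one_div, ENNReal.le_rpow_inv_iff two_pos, hsq]
        exact ENNReal.le_tsum (f := fun k : {k : ℤ // -1 ≤ k} =>
          (2 : ℝ≥0∞) ^ (2 * (β + δ) * ((k : ℤ) : ℝ)) * a k ^ 2) k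

/-- sequence-level estimate for the high-high paraproduct
contribution `D₃`: with the convention `a₋₂ = 0`,
`Σ_{k≥-1} 2^{βk} a_k (Σ_{ℓ≥max(k-1,-1)} a_ℓ (a_{ℓ-1}+a_ℓ+a_{ℓ+1}))
  ≤ C_{β,δ} (Σ_{k≥-1} 2^{2(β+δ)k} a_k²)^{1/2} (Σ_{k≥-1} a_k²)`,
interpreted in `[0,∞]`. -/
theorem statement4 (β δ : ℝ) (hδ : 0 < δ) :
    ∃ C : ℝ, 0 < C ∧ ∀ a : ℤ → ℝ≥0∞, a (-2) = 0 →
      (∑' k : {k : ℤ // -1 ≤ k},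
          (2 : ℝ≥0∞) ^ (β * ((k : ℤ) : ℝ)) * a k *
            ∑' ℓ : {ℓ : ℤ // max ((k : ℤ) - 1) (-1) ≤ ℓ},
              a ℓ * (a ((ℓ : ℤ) - 1) + a ℓ + a ((ℓ : ℤ) + 1))) ≤
        ENNReal.ofReal C *
          (∑' k : {k : ℤ // -1 ≤ k},
              (2 : ℝ≥0∞) ^ (2 * (β + δ) * ((k : ℤ) : ℝ)) * a k ^ 2) ^ ((1 : ℝ) / 2) *
          (∑' k : {k : ℤ // -1 ≤ k}, a k ^ 2) := by
  set D := ∑' k : {k : ℤ // -1 ≤ k}, (2 : ℝ≥0∞) ^ (-δ * ((k : ℤ) : ℝ))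
  have hDtop : D ≠ ∞ := tsum_two_rpow_neg_mul_ne_top hδ
  have hDC : D * 5 ≤ ENNReal.ofReal ((D * 5).toReal + 1) :=
    (ENNReal.le_ofReal_iff_toReal_le (ENNReal.mul_ne_top hDtop ENNReal.ofNat_ne_top)
      (by positivity)).mpr (by linarith)
  refine ⟨(D * 5).toReal + 1, by positivity, fun a ha => ?_⟩
  set W := (∑' k : {k : ℤ // -1 ≤ k},
    (2 : ℝ≥0∞) ^ (2 * (β + δ) * ((k : ℤ) : ℝ)) * a k ^ 2) ^ ((1 : ℝ) / 2)
  set S := ∑' k : {k : ℤ // -1 ≤ k}, a k ^ 2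
  calc _ ≤ ∑' k : {k : ℤ // -1 ≤ k}, (2 : ℝ≥0∞) ^ (β * ((k : ℤ) : ℝ)) * a k * (5 * S) :=
        ENNReal.tsum_le_tsum fun k =>
          mul_le_mul_right (tsum_mul_neighbours_le ha (le_max_right _ _)) _
    _ ≤ D * W * (5 * S) := by
        rw [ENNReal.tsum_mul_right]
        gcongr
        exact tsum_two_rpow_mul_le β δ a
    _ = D * 5 * W * S := by ring
    _ ≤ _ := by gcongr
end
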